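/- The space E([0,T], S_d) endowed with the metric d(x,y) = Σ_{m≥1} 2^{−m} d_S(R_m x, R_m y) is a complete separable metric space. -/

import Mathlib

open Filter Topology Set

noncomputable section
namespace Soft

abbrev Sd := ℕ∞

noncomputable def sval (k : Sd) : ℝ := if k = ⊤ then 0 else 1 / ((k.toNat : ℝ) + 1)

noncomputable def sdist (k j : Sd) : ℝ := |sval k - sval j|

/-- left-limit filter within `[0,T]` -/
def lf (T t : ℝ) : Filter ℝ := 𝓝[Set.Icc 0 T ∩ Set.Iio t] t

/-- right-limit filter within `[0,T]` -/
def rf (T t : ℝ) : Filter ℝ := 𝓝[Set.Icc 0 T ∩ Set.Ioi t] t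

def leftLim (T : ℝ) (x : ℝ → Sd) (t : ℝ) (L : Sd) : Prop := Tendsto x (lf T t) (𝓝 L)

def rightLim (T : ℝ) (x : ℝ → Sd) (t : ℝ) (L : Sd) : Prop := Tendsto x (rf T t) (𝓝 L)

/-- the set of cluster points of `x(s)`, `s ↑ t`, is exactly the pair `{n, ∞}` -/
def softLeftPair (T : ℝ) (x : ℝ → Sd) (t : ℝ) (n : ℕ) : Prop :=
  {L : Sd | MapClusterPt L (lf T t) x} = {(n : Sd), ⊤}

def softRightPair (T : ℝ) (x : ℝ → Sd) (t : ℝ) (n : ℕ) : Prop :=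
  {L : Sd | MapClusterPt L (rf T t) x} = {(n : Sd), ⊤}

/-- `x` has a soft left-limit at `t` -/
def softLeftLim (T : ℝ) (x : ℝ → Sd) (t : ℝ) : Prop :=
  (∃ L, leftLim T x t L) ∨ ∃ n : ℕ, softLeftPair T x t n

/-- `x` is soft right-continuous at `t` -/
def softRightCont (T : ℝ) (x : ℝ → Sd) (t : ℝ) : Prop :=
  rightLim T x t ⊤ ∨ (∃ n : ℕ, rightLim T x t (n : Sd) ∧ x t = (n : Sd)) ∨
    ∃ n : ℕ, softRightPair T x t n ∧ x t = (n : Sd)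

/-- the space `𝔼([0,T], S_d)` of soft right-continuous trajectories with soft left-limits -/
def memBbE (T : ℝ) (x : ℝ → Sd) : Prop :=
  (∀ t ∈ Set.Icc 0 T, softRightCont T x t) ∧ ∀ t ∈ Set.Ioc 0 T, softLeftLim T x t

/-- time of last visit before `t` to the set `{k : P k}` (with the convention `= 0`
if there is no such visit, since `sSup ∅ = 0` in `ℝ`) -/
def lastVisit (P : Sd → Prop) (x : ℝ → Sd) (t : ℝ) : ℝ :=
  sSup {s | s ∈ Set.Icc 0 t ∧ P (x s)}

open Classical in
/-- the record operator: the last value in `{k : P k}` visited by `x` before time `t`;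
equal to the bottom state `0` before the first visit -/
noncomputable def srec (T : ℝ) (P : Sd → Prop) (x : ℝ → Sd) (t : ℝ) : Sd :=
  if ∃ s ∈ Set.Icc 0 t, P (x s) then
    if P (x (lastVisit P x t)) then x (lastVisit P x t)
    else if h : ∃ L, leftLim T x (lastVisit P x t) L then h.choose
    else if h2 : ∃ n : ℕ, softLeftPair T x (lastVisit P x t) n then (h2.choose : Sd)
    else 0
  else 0

/-- `R_m`, the operator recording the last site visited in `S_m = {0,…,m}` -/
noncomputable def Rm (T : ℝ) (m : ℕ) (x : ℝ → Sd) : ℝ → Sd :=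
  srec T (fun k => k ≤ (m : Sd)) x

/-- `R_∞`, the operator recording the last site visited in `ℕ` -/
noncomputable def Rinf (T : ℝ) (x : ℝ → Sd) : ℝ → Sd := srec T (fun k => k ≠ ⊤) x

/-- `σ_∞(t)`, the time of the last visit to `ℕ` before `t` -/
def sigmaInf (x : ℝ → Sd) (t : ℝ) : ℝ := lastVisit (fun k => k ≠ ⊤) x t

/-- `D([0,T], S_m)`: càdlàg trajectories with values in `S_m = {0,…,m}` -/
def memD (T : ℝ) (m : ℕ) (x : ℝ → Sd) : Prop :=
  (∀ t ∈ Set.Icc 0 T, x t ≤ (m : Sd)) ∧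
  (∀ t ∈ Set.Ico 0 T, rightLim T x t (x t)) ∧
  ∀ t ∈ Set.Ioc 0 T, ∃ L, leftLim T x t L

/-- `D([0,T], S_d)`: càdlàg trajectories with values in `S_d` -/
def memDd (T : ℝ) (x : ℝ → Sd) : Prop :=
  (∀ t ∈ Set.Ico 0 T, rightLim T x t (x t)) ∧
  ∀ t ∈ Set.Ioc 0 T, ∃ L, leftLim T x t L

/-- the space `E([0,T], S_d)` -/
def memE (T : ℝ) (x : ℝ → Sd) : Prop :=
  memBbE T x ∧ x 0 ≠ ⊤ ∧
  ∀ t ∈ Set.Ioc 0 T, x t = ⊤ →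
    0 < sigmaInf x t ∧ x (sigmaInf x t) = ⊤ ∧ leftLim T x (sigmaInf x t) ⊤

/-- `Λ_T(x)`, the time spent at `∞` -/
noncomputable def LambdaT (T : ℝ) (x : ℝ → Sd) : ℝ :=
  (MeasureTheory.volume {s | s ∈ Set.Icc 0 T ∧ x s = ⊤}).toReal

/-- `D^*([0,T], S_d)`: càdlàg trajectories spending no time at `∞`, continuous at `T` -/
def memDstar (T : ℝ) (x : ℝ → Sd) : Prop :=
  memDd T x ∧ LambdaT T x = 0 ∧ leftLim T x T (x T)

/-- `E^*([0,T], S_d)`: the image of `D^*([0,T], S_d)` under `R_∞` -/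
def memEstar (T : ℝ) (x : ℝ → Sd) : Prop :=
  memE T x ∧ ∃ y, memDstar T y ∧ Set.EqOn (Rinf T y) x (Set.Icc 0 T)

/-- the set `Λ` of time changes: increasing continuous bijections of `[0,T]` fixing `0, T` -/
def TimeChange (T : ℝ) (l : ℝ → ℝ) : Prop :=
  l 0 = 0 ∧ l T = T ∧ ContinuousOn l (Set.Icc 0 T) ∧ StrictMonoOn l (Set.Icc 0 T) ∧
    Set.MapsTo l (Set.Icc 0 T) (Set.Icc 0 T)

/-- the Skorohod metric -/
noncomputable def dS (T : ℝ) (x y : ℝ → Sd) : ℝ :=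
  sInf {a : ℝ | ∃ l, TimeChange T l ∧
    (∀ t ∈ Set.Icc 0 T, sdist (x t) (y (l t)) ≤ a) ∧
    ∀ s ∈ Set.Icc 0 T, ∀ t ∈ Set.Icc 0 T, s < t → |Real.log ((l t - l s) / (t - s))| ≤ a}

/-- the soft metric `d(x,y) = Σ_m 2^{-(m+1)} d_S(R_m x, R_m y)` -/
noncomputable def dE (T : ℝ) (x y : ℝ → Sd) : ℝ :=
  ∑' m : ℕ, (1 / 2 : ℝ) ^ (m + 1) * dS T (Rm T m x) (Rm T m y)

/-- the left endpoints of the maximal intervals on which `x = j` -/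
def entryPoints (T : ℝ) (j : Sd) (x : ℝ → Sd) : Set ℝ :=
  {t | t ∈ Set.Icc 0 T ∧ x t = j ∧
    (t = 0 ∨ ∀ δ > 0, ∃ s ∈ Set.Ioo (t - δ) t ∩ Set.Icc 0 T, x s ≠ j)}

/-- `N_j(x)`, the number of visits of `x` to `j` -/
noncomputable def Nvisits (T : ℝ) (j : Sd) (x : ℝ → Sd) : ℕ := (entryPoints T j x).ncard

/-- the start of the `(l+1)`-th visit to `j` (0-indexed) -/
noncomputable def nthEntry (T : ℝ) (j : Sd) (x : ℝ → Sd) (l : ℕ) : ℝ :=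
  sInf {e | e ∈ entryPoints T j x ∧ {s | s ∈ entryPoints T j x ∧ s < e}.ncard = l}

noncomputable def exitTime (T : ℝ) (j : Sd) (x : ℝ → Sd) (t : ℝ) : ℝ :=
  sInf ({s | s ∈ Set.Ioc t T ∧ x s ≠ j} ∪ {T})

/-- `T_{j,l}(x)`, the length of the `l`-th holding interval at `j` (1-indexed),
`0` if `l > N_j(x)` -/
noncomputable def holdingTime (T : ℝ) (j : Sd) (x : ℝ → Sd) (l : ℕ) : ℝ :=
  if 1 ≤ l ∧ l ≤ Nvisits T j x then
    exitTime T j x (nthEntry T j x (l - 1)) - nthEntry T j x (l - 1)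
  else 0

end Soft


noncomputable section
open Filter Topology Set

namespace Soft

theorem lf_iff (T t : ℝ) (P : ℝ → Prop) : (∀ᶠ s in lf T t, P s) ↔
    ∃ a < t, ∀ s ∈ Icc 0 T, a < s → s < t → P s := by
  unfold lf
  rw [eventually_nhdsWithin_iff, Metric.eventually_nhds_iff]
  constructor
  · rintro ⟨ε, hε, h⟩
    refine ⟨t - ε, by linarith, fun s hs h1 h2 => h ?_ ⟨hs, h2⟩⟩
    rw [Real.dist_eq, abs_lt]; constructor <;> linarith
  · rintro ⟨a, ha, h⟩
    refine ⟨t - a, by linarith, fun s hs h1 => h s h1.1 ?_ h1.2⟩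
    rw [Real.dist_eq, abs_lt] at hs; linarith [hs.1]

theorem rf_iff (T t : ℝ) (P : ℝ → Prop) : (∀ᶠ s in rf T t, P s) ↔
    ∃ b > t, ∀ s ∈ Icc 0 T, t < s → s < b → P s := by
  unfold rf
  rw [eventually_nhdsWithin_iff, Metric.eventually_nhds_iff]
  constructor
  · rintro ⟨ε, hε, h⟩
    refine ⟨t + ε, by linarith, fun s hs h1 h2 => h ?_ ⟨hs, h1⟩⟩
    rw [Real.dist_eq, abs_lt]; constructor <;> linarith
  · rintro ⟨a, ha, h⟩
    refine ⟨a - t, by linarith, fun s hs h1 => h s h1.1 h1.2 ?_⟩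
    rw [Real.dist_eq, abs_lt] at hs; linarith [hs.2]

theorem lf_neBot {T t : ℝ} (ht : t ∈ Ioc 0 T) : (lf T t).NeBot := by
  rw [← frequently_true_iff_neBot, Filter.Frequently, lf_iff]
  rintro ⟨a, ha, h⟩
  have h0 := ht.1
  have h1 := ht.2
  have hm : max a 0 < t := max_lt ha h0
  have := le_max_left a 0
  have := le_max_right a 0
  exact h ((max a 0 + t) / 2) ⟨by linarith, by linarith⟩ (by linarith) (by linarith) trivial

theorem rf_neBot {T t : ℝ} (ht : t ∈ Ico 0 T) : (rf T t).NeBot := by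
  rw [← frequently_true_iff_neBot, Filter.Frequently, rf_iff]
  rintro ⟨a, ha, h⟩
  have h0 := ht.1
  have h1 := ht.2
  have hm : t < min a T := lt_min ha h1
  have := min_le_left a T
  have := min_le_right a T
  exact h ((min a T + t) / 2) ⟨by linarith, by linarith⟩ (by linarith) (by linarith) trivial

/-- the soft-limit property along a filter -/
def Sl (F : Filter ℝ) (f : ℝ → Sd) (n : ℕ) : Prop :=
  ∀ m : ℕ, ∀ᶠ s in F, f s ≤ (m : Sd) → f s = (n : Sd)

theorem tendsto_nat_iff (F : Filter ℝ) (f : ℝ → Sd) (n : ℕ) :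
    Tendsto f F (𝓝 (n : Sd)) ↔ ∀ᶠ s in F, f s = (n : Sd) := by
  rw [ENat.nhds_natCast, tendsto_pure]

theorem tendsto_top_iff (F : Filter ℝ) (f : ℝ → Sd) :
    Tendsto f F (𝓝 (⊤ : Sd)) ↔ ∀ m : ℕ, ∀ᶠ s in F, (m : Sd) < f s :=
  ENat.tendsto_nhds_top_iff_natCast_lt

theorem Sl_of_nat {F : Filter ℝ} {f : ℝ → Sd} {n : ℕ} (h : Tendsto f F (𝓝 (n : Sd))) :
    Sl F f n := fun _ => ((tendsto_nat_iff F f n).1 h).mono fun _ hs _ => hs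

theorem Sl_of_top {F : Filter ℝ} {f : ℝ → Sd} (n : ℕ) (h : Tendsto f F (𝓝 (⊤ : Sd))) :
    Sl F f n := fun m => ((tendsto_top_iff F f).1 h m).mono fun _ hs h2 => absurd h2 (not_le.2 hs)

theorem finite_Iic_nat (m : ℕ) : (Iic (m : Sd)).Finite := by
  refine ((Set.finite_Iic m).image (fun k : ℕ => (k : Sd))).subset ?_
  intro k hk
  have hk' : k ≤ (m : Sd) := hk
  obtain ⟨n, rfl⟩ := ENat.ne_top_iff_exists.1 (ne_top_of_le_ne_top (ENat.natCast_ne_top m) hk')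
  exact ⟨n, by simpa using hk', rfl⟩

theorem Sl_of_pair {F : Filter ℝ} {f : ℝ → Sd} {n : ℕ}
    (h : {L : Sd | MapClusterPt L F f} = {(n : Sd), ⊤}) : Sl F f n := by
  intro m
  by_contra hc
  have hc' : ∃ᶠ s in F, f s ∈ (Iic (m : Sd) \ {(n : Sd)}) := by
    refine (Filter.not_eventually.1 hc).mono ?_
    intro s hs
    push Not at hs
    exact ⟨hs.1, hs.2⟩
  have hK : IsCompact (Iic (m : Sd) \ {(n : Sd)}) := ((finite_Iic_nat m).sdiff).isCompact
  obtain ⟨L, hL, hcl⟩ := hK.exists_mapClusterPt_of_frequently hc'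
  have : L ∈ ({(n : Sd), ⊤} : Set Sd) := by rw [← h]; exact hcl
  rcases this with rfl | rfl
  · exact hL.2 rfl
  · have := hL.1
    simp at this

theorem Sl_cases {F : Filter ℝ} {f : ℝ → Sd} {n : ℕ} (h : Sl F f n) :
    Tendsto f F (𝓝 (n : Sd)) ∨ Tendsto f F (𝓝 (⊤ : Sd)) ∨
      {L : Sd | MapClusterPt L F f} = {(n : Sd), ⊤} := by
  by_cases h1 : ∀ᶠ s in F, f s = (n : Sd)
  · exact Or.inl ((tendsto_nat_iff F f n).2 h1)
  by_cases h2 : ∀ᶠ s in F, f s ≠ (n : Sd)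
  · refine Or.inr (Or.inl ((tendsto_top_iff F f).2 fun m => ?_))
    filter_upwards [h m, h2] with s hs hs2
    exact not_le.1 fun hle => hs2 (hs hle)
  refine Or.inr (Or.inr ?_)
  have h1' : ∃ᶠ s in F, f s ≠ (n : Sd) := Filter.not_eventually.1 h1
  have h2' : ∃ᶠ s in F, f s = (n : Sd) := by
    have := Filter.not_eventually.1 h2
    exact this.mono fun s hs => not_not.1 hs
  ext L
  simp only [mem_ofPred_eq, mem_insert_iff, mem_singleton_iff, mapClusterPt_iff_frequently]
  constructor
  · intro hL
    by_contra hc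
    push Not at hc
    obtain ⟨k, rfl⟩ := ENat.ne_top_iff_exists.1 hc.2
    have h3 : ∃ᶠ s in F, f s ∈ ({(k : Sd)} : Set Sd) := by
      apply hL
      rw [ENat.nhds_natCast]; simp
    obtain ⟨s, hs1, hs2⟩ := (h3.and_eventually (h k)).exists
    have hs1' : f s = (k : Sd) := hs1
    exact hc.1 (hs1' ▸ hs2 hs1'.le)
  · rintro (rfl | rfl) U hU
    · exact h2'.mono fun s hs => by rw [hs]; exact mem_of_mem_nhds hU
    · obtain ⟨a, ha, hsub⟩ := exists_Ioc_subset_of_mem_nhds hU ⟨0, by simp⟩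
      obtain ⟨k, rfl⟩ := ENat.ne_top_iff_exists.1 ha.ne
      refine (h1'.and_eventually (h k)).mono ?_
      rintro s ⟨hs1, hs2⟩
      exact hsub ⟨not_le.1 fun hle => hs1 (hs2 hle), le_top⟩

theorem softLeftLim_iff (T : ℝ) (x : ℝ → Sd) (t : ℝ) :
    softLeftLim T x t ↔ ∃ n : ℕ, Sl (lf T t) x n := by
  constructor
  · rintro (⟨L, hL⟩ | ⟨n, hn⟩)
    · by_cases h : L = ⊤
      · subst h; exact ⟨0, Sl_of_top 0 hL⟩
      · obtain ⟨n, rfl⟩ := ENat.ne_top_iff_exists.1 h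
        exact ⟨n, Sl_of_nat hL⟩
    · exact ⟨n, Sl_of_pair hn⟩
  · rintro ⟨n, hn⟩
    rcases Sl_cases hn with h | h | h
    · exact Or.inl ⟨_, h⟩
    · exact Or.inl ⟨_, h⟩
    · exact Or.inr ⟨n, h⟩

theorem softRight_ev {T : ℝ} {x : ℝ → Sd} {t : ℝ} (h : softRightCont T x t) (m : ℕ) :
    ∀ᶠ s in rf T t, x s ≤ (m : Sd) → x s = x t := by
  rcases h with h | ⟨n, h, hx⟩ | ⟨n, h, hx⟩
  · exact ((tendsto_top_iff _ _).1 h m).mono fun _ hs h2 => absurd h2 (not_le.2 hs)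
  · rw [hx]; exact Sl_of_nat h m
  · rw [hx]; exact Sl_of_pair h m

/-- relational description of the recorded value -/
def Rec (m : ℕ) (x : ℝ → Sd) (t : ℝ) (v : Sd) : Prop :=
  ((∀ s ∈ Icc 0 t, ¬ x s ≤ (m : Sd)) ∧ v = 0) ∨
  ((∃ s ∈ Icc 0 t, x s = v ∧ ∀ r ∈ Icc s t, x r ≤ (m : Sd) → x r = v) ∧ v ≤ (m : Sd))

theorem Rec.le {m : ℕ} {x : ℝ → Sd} {t : ℝ} {v : Sd} (h : Rec m x t v) : v ≤ (m : Sd) := by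
  rcases h with ⟨_, rfl⟩ | ⟨_, h⟩
  · simp
  · exact h

theorem Rec.eq_of_le {m : ℕ} {x : ℝ → Sd} {t : ℝ} {v : Sd} (h : Rec m x t v) (ht : 0 ≤ t)
    (hx : x t ≤ (m : Sd)) : x t = v := by
  rcases h with ⟨h, _⟩ | ⟨⟨s, hs, _, h⟩, _⟩
  · exact absurd hx (h t ⟨ht, le_rfl⟩)
  · exact h t ⟨hs.2, le_rfl⟩ hx

theorem Rec.unique {m : ℕ} {x : ℝ → Sd} {t : ℝ} {v w : Sd} (h : Rec m x t v)
    (h' : Rec m x t w) : v = w := by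
  rcases h with ⟨h, rfl⟩ | ⟨⟨s, hs, hsv, h⟩, hv⟩
  · rcases h' with ⟨_, rfl⟩ | ⟨⟨s, hs, hsv, _⟩, hw⟩
    · rfl
    · exact absurd (hsv ▸ hw) (h s hs)
  · rcases h' with ⟨h', rfl⟩ | ⟨⟨s', hs', hsw, h'⟩, hw⟩
    · exact absurd (hsv ▸ hv) (h' s hs)
    · rcases le_total s s' with hss | hss
      · rw [← hsw]; exact (h s' ⟨hss, hs'.2⟩ (hsw ▸ hw)).symm
      · rw [← hsv]; exact h' s ⟨hss, hs.2⟩ (hsv ▸ hv)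

theorem Rec.extend {m : ℕ} {x : ℝ → Sd} {t s : ℝ} {v : Sd} (h : Rec m x t v) (ht : 0 ≤ t)
    (hts : t ≤ s) (hx : ∀ r, t < r → r ≤ s → x r ≤ (m : Sd) → x r = v) : Rec m x s v := by
  rcases h with ⟨h, rfl⟩ | ⟨⟨s', hs', hsv, h⟩, hv⟩
  · by_cases hc : ∃ r0, t < r0 ∧ r0 ≤ s ∧ x r0 ≤ (m : Sd)
    · obtain ⟨r0, h1, h2, h3⟩ := hc
      refine Or.inr ⟨⟨r0, ⟨by linarith, h2⟩, hx r0 h1 h2 h3, fun r hr hr2 =>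
        hx r (lt_of_lt_of_le h1 hr.1) hr.2 hr2⟩, by simp⟩
    · refine Or.inl ⟨fun r hr hr2 => ?_, rfl⟩
      rcases le_or_gt r t with h1 | h1
      · exact h r ⟨hr.1, h1⟩ hr2
      · exact hc ⟨r, h1, hr.2, hr2⟩
  · refine Or.inr ⟨⟨s', ⟨hs'.1, hs'.2.trans hts⟩, hsv, fun r hr hr2 => ?_⟩, hv⟩
    rcases le_or_gt r t with h1 | h1
    · exact h r ⟨hr.1, h1⟩ hr2
    · exact hx r h1 hr.2 hr2

theorem Rec.congr {m : ℕ} {x y : ℝ → Sd} {t : ℝ} {v : Sd} (h : Rec m x t v)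
    (hxy : ∀ s ∈ Icc 0 t, x s = y s) : Rec m y t v := by
  rcases h with ⟨h, rfl⟩ | ⟨⟨s, hs, hsv, h⟩, hv⟩
  · exact Or.inl ⟨fun s hs => hxy s hs ▸ h s hs, rfl⟩
  · refine Or.inr ⟨⟨s, hs, hxy s hs ▸ hsv, fun r hr hr2 => ?_⟩, hv⟩
    have := hxy r ⟨hs.1.trans hr.1, hr.2⟩
    rw [← this] at hr2 ⊢
    exact h r hr hr2

/-- recording in two steps -/
theorem Rec.trans {j m : ℕ} (hjm : j ≤ m) {x w : ℝ → Sd} {t : ℝ} {v : Sd}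
    (hw : ∀ s ∈ Icc 0 t, Rec m x s (w s)) (h : Rec j x t v) : Rec j w t v := by
  have hjm' : (j : Sd) ≤ (m : Sd) := by exact_mod_cast hjm
  rcases h with ⟨h, rfl⟩ | ⟨⟨s, hs, hsv, h⟩, hv⟩
  · have key : ∀ s ∈ Icc 0 t, w s ≤ (j : Sd) → w s = 0 := by
      intro s hs hle
      rcases hw s hs with ⟨_, h0⟩ | ⟨⟨s', hs', hsv, _⟩, _⟩
      · exact h0
      · exact absurd (hsv ▸ hle) (h s' ⟨hs'.1, hs'.2.trans hs.2⟩)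
    by_cases hc : ∃ s ∈ Icc 0 t, w s ≤ (j : Sd)
    · obtain ⟨s, hs, hle⟩ := hc
      exact Or.inr ⟨⟨s, hs, key s hs hle, fun r hr hr2 =>
        key r ⟨hs.1.trans hr.1, hr.2⟩ hr2⟩, by simp⟩
    · push Not at hc
      exact Or.inl ⟨fun s hs => not_le.2 (hc s hs), rfl⟩
  · have hle : x s ≤ (m : Sd) := hsv ▸ hv.trans hjm'
    refine Or.inr ⟨⟨s, hs, ?_, fun r hr hr2 => ?_⟩, hv⟩
    · rw [← (hw s hs).eq_of_le hs.1 hle, hsv]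
    · rcases hw r ⟨hs.1.trans hr.1, hr.2⟩ with ⟨h0, _⟩ | ⟨⟨s', hs', hsv', h'⟩, _⟩
      · exact absurd hle (h0 s ⟨hs.1, hr.1⟩)
      · rcases le_total s s' with hss | hss
        · rw [← hsv'] at hr2 ⊢
          exact h s' ⟨hss, hs'.2.trans hr.2⟩ hr2
        · rw [← h' s ⟨hss, hr.1⟩ hle, hsv]

theorem Rm_spec {T : ℝ} {x : ℝ → Sd} (hx : ∀ t ∈ Ioc 0 T, softLeftLim T x t) (m : ℕ)
    {t : ℝ} (ht : t ∈ Icc 0 T) : Rec m x t (Rm T m x t) := by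
  unfold Rm srec
  set P : Sd → Prop := fun k => k ≤ (m : Sd) with hP
  by_cases hv : ∃ s ∈ Icc 0 t, P (x s)
  swap
  · rw [if_neg hv]
    push Not at hv
    exact Or.inl ⟨hv, rfl⟩
  rw [if_pos hv]
  set S : Set ℝ := {s | s ∈ Icc 0 t ∧ P (x s)} with hS
  have hσdef : lastVisit P x t = sSup S := rfl
  rw [hσdef]
  set σ := sSup S with hσ
  have hne : S.Nonempty := by obtain ⟨s, hs, hs2⟩ := hv; exact ⟨s, hs, hs2⟩
  have hbdd : BddAbove S := ⟨t, fun s hs => hs.1.2⟩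
  have hσt : σ ≤ t := csSup_le hne fun s hs => hs.1.2
  have hσ0 : 0 ≤ σ := by obtain ⟨s, hs⟩ := hne; exact hs.1.1.trans (le_csSup hbdd hs)
  have hup : ∀ r ∈ Icc 0 t, x r ≤ (m : Sd) → r ≤ σ := fun r hr h => le_csSup hbdd ⟨hr, h⟩
  by_cases hσP : P (x σ)
  · rw [if_pos hσP]
    refine Or.inr ⟨⟨σ, ⟨hσ0, hσt⟩, rfl, fun r hr h => ?_⟩, hσP⟩
    have : r = σ := le_antisymm (hup r ⟨hσ0.trans hr.1, hr.2⟩ h) hr.1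
    rw [this]
  rw [if_neg hσP]
  have hlt : ∀ r ∈ Icc 0 t, x r ≤ (m : Sd) → r < σ := fun r hr h =>
    lt_of_le_of_ne (hup r hr h) fun he => hσP (he ▸ h)
  have hσpos : 0 < σ := by
    obtain ⟨s, hs⟩ := hne
    exact lt_of_le_of_lt hs.1.1 (hlt s hs.1 hs.2)
  have hσT : σ ∈ Ioc 0 T := ⟨hσpos, hσt.trans ht.2⟩
  -- frequently visiting
  have key : ∀ n : ℕ, Sl (lf T σ) x n → Rec m x t (n : Sd) := by
    intro n hn
    obtain ⟨a, ha, h⟩ := (lf_iff _ _ _).1 (hn m)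
    obtain ⟨s, hs, has⟩ := exists_lt_of_lt_csSup hne ha
    have hsσ := hlt s hs.1 hs.2
    have hsn : x s = n := h s ⟨hs.1.1, hs.1.2.trans ht.2⟩ has hsσ hs.2
    refine Or.inr ⟨⟨s, hs.1, hsn, fun r hr hr2 => ?_⟩, hsn ▸ hs.2⟩
    have hr0 : 0 ≤ r := hs.1.1.trans hr.1
    exact h r ⟨hr0, hr.2.trans ht.2⟩ (lt_of_lt_of_le has hr.1) (hlt r ⟨hr0, hr.2⟩ hr2) hr2
  by_cases h1 : ∃ L, leftLim T x σ L
  · rw [dif_pos h1]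
    have hL := h1.choose_spec
    set L := h1.choose
    by_cases hLt : L = ⊤
    · exfalso
      rw [hLt] at hL
      obtain ⟨a, ha, h⟩ := (lf_iff _ _ _).1 ((tendsto_top_iff _ _).1 hL m)
      obtain ⟨s, hs, has⟩ := exists_lt_of_lt_csSup hne ha
      exact absurd hs.2 (not_le.2 (h s ⟨hs.1.1, hs.1.2.trans ht.2⟩ has (hlt s hs.1 hs.2)))
    · obtain ⟨n, hn⟩ := ENat.ne_top_iff_exists.1 hLt
      rw [← hn] at hL ⊢
      exact key n (Sl_of_nat hL)
  rw [dif_neg h1]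
  by_cases h2 : ∃ n : ℕ, softLeftPair T x σ n
  · rw [dif_pos h2]
    exact key _ (Sl_of_pair h2.choose_spec)
  · exfalso
    rcases hx σ hσT with h | h
    · exact h1 h
    · exact h2 h

theorem Rm_eq {T : ℝ} {x : ℝ → Sd} (hx : ∀ t ∈ Ioc 0 T, softLeftLim T x t) {m : ℕ}
    {t : ℝ} (ht : t ∈ Icc 0 T) {v : Sd} (h : Rec m x t v) : Rm T m x t = v :=
  (Rm_spec hx m ht).unique h

/-- piecewise constant right-continuous -/
def PC (T : ℝ) (w : ℝ → Sd) : Prop :=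
  (∀ t ∈ Ico 0 T, ∃ b > t, ∀ s ∈ Icc 0 T, t < s → s < b → w s = w t) ∧
  (∀ t ∈ Ioc 0 T, ∃ a < t, ∃ c, ∀ s ∈ Icc 0 T, a < s → s < t → w s = c)

theorem PC.softLeft {T : ℝ} {w : ℝ → Sd} (h : PC T w) : ∀ t ∈ Ioc 0 T, softLeftLim T w t := by
  intro t ht
  obtain ⟨a, ha, c, hc⟩ := h.2 t ht
  refine Or.inl ⟨c, ?_⟩
  refine Tendsto.congr' (f₁ := fun _ => c) ?_ tendsto_const_nhds
  exact (lf_iff _ _ _).2 ⟨a, ha, fun s hs h1 h2 => (hc s hs h1 h2).symm⟩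

theorem PC.memE {T : ℝ} {w : ℝ → Sd} (hT : 0 < T) (h : PC T w) (hw : ∀ t, w t ≠ ⊤) :
    memE T w := by
  refine ⟨⟨fun t ht => ?_, h.softLeft⟩, hw 0, fun t _ h => absurd h (hw t)⟩
  rcases eq_or_lt_of_le ht.2 with rfl | hlt
  · refine Or.inl ((tendsto_top_iff _ _).2 fun m => (rf_iff _ _ _).2 ⟨t + 1, by linarith, ?_⟩)
    intro s hs h1
    exact absurd hs.2 (not_le.2 h1)
  · obtain ⟨n, hn⟩ := ENat.ne_top_iff_exists.1 (hw t)
    refine Or.inr (Or.inl ⟨n, (tendsto_nat_iff _ _ _).2 ((rf_iff _ _ _).2 ?_), hn.symm⟩)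
    rw [hn]
    exact h.1 t ⟨ht.1, hlt⟩

theorem Rm_PC {T : ℝ} {x : ℝ → Sd} (hx : memBbE T x) (m : ℕ) : PC T (Rm T m x) := by
  constructor
  · intro t ht
    obtain ⟨b, hb, h⟩ := (rf_iff _ _ _).1 (softRight_ev (hx.1 t ⟨ht.1, ht.2.le⟩) m)
    refine ⟨b, hb, fun s hs hts hsb => Rm_eq hx.2 hs ?_⟩
    have hR := Rm_spec hx.2 m (t := t) ⟨ht.1, ht.2.le⟩
    refine hR.extend ht.1 hts.le fun r hr1 hr2 hr3 => ?_
    have := h r ⟨ht.1.trans hr1.le, hr2.trans hs.2⟩ hr1 (lt_of_le_of_lt hr2 hsb) hr3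
    rw [this] at hr3 ⊢
    exact hR.eq_of_le ht.1 hr3
  · intro t ht
    obtain ⟨n, hn⟩ := (softLeftLim_iff _ _ _).1 (hx.2 t ht)
    obtain ⟨a, ha, h⟩ := (lf_iff _ _ _).1 (hn m)
    have : ∃ s1, 0 ≤ s1 ∧ a < s1 ∧ s1 < t ∧ (x s1 ≤ (m : Sd) ∨
        ∀ r, s1 < r → r < t → ¬ x r ≤ (m : Sd)) := by
      by_cases hc : ∃ s1, 0 ≤ s1 ∧ a < s1 ∧ s1 < t ∧ x s1 ≤ (m : Sd)
      · obtain ⟨s1, h1, h2, h3, h4⟩ := hc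
        exact ⟨s1, h1, h2, h3, Or.inl h4⟩
      · have hm : max a 0 < t := max_lt ha ht.1
        have := le_max_left a 0
        have := le_max_right a 0
        refine ⟨(max a 0 + t) / 2, by linarith [ht.1], by linarith, by linarith, Or.inr ?_⟩
        intro r h1 h2 h3
        exact hc ⟨r, by linarith [ht.1], by linarith, h2, h3⟩
    obtain ⟨s1, h1, h2, h3, h4⟩ := this
    refine ⟨s1, h3, Rm T m x s1, fun s hs hs1 hst => Rm_eq hx.2 hs ?_⟩
    have hs1T : s1 ∈ Icc 0 T := ⟨h1, h3.le.trans ht.2⟩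
    have hR := Rm_spec hx.2 m hs1T
    refine hR.extend h1 hs1.le fun r hr1 hr2 hr3 => ?_
    rcases h4 with h4 | h4
    · rw [← hR.eq_of_le h1 h4, h s1 hs1T h2 h3 h4]
      exact h r ⟨h1.trans hr1.le, hr2.trans hs.2⟩ (by linarith) (by linarith) hr3
    · exact absurd hr3 (h4 r hr1 (by linarith))

end Soft

namespace Soft

theorem seq_mono {a : ℕ → Sd} (h1 : ∀ j : ℕ, a j ≤ (j : Sd))
    (h2 : ∀ j : ℕ, a (j + 1) = a j ∨ a (j + 1) = ((j + 1 : ℕ) : Sd)) : Monotone a := by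
  refine monotone_nat_of_le_succ fun j => ?_
  rcases h2 j with h | h
  · rw [h]
  · rw [h]; exact (h1 j).trans (by exact_mod_cast Nat.le_succ j)

theorem seq_sup {a : ℕ → Sd} (h1 : ∀ j : ℕ, a j ≤ (j : Sd))
    (h2 : ∀ j : ℕ, a (j + 1) = a j ∨ a (j + 1) = ((j + 1 : ℕ) : Sd)) {m : ℕ}
    (hm : (⨆ j, a j) ≤ (m : Sd)) : (⨆ j, a j) = a m := by
  have hconst : ∀ i, a (m + i) = a m := by
    intro i
    induction i with
    | zero => rfl
    | succ i ih =>
      rcases h2 (m + i) with h | h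
      · rw [← ih, ← h]; rfl
      · exfalso
        have h3 : a (m + i + 1) ≤ (m : Sd) := (le_iSup a _).trans hm
        rw [h] at h3
        have : m + i + 1 ≤ m := by exact_mod_cast h3
        omega
  apply le_antisymm
  · refine iSup_le fun j => ?_
    rcases le_total j m with h | h
    · exact seq_mono h1 h2 h
    · obtain ⟨i, rfl⟩ := Nat.exists_eq_add_of_le h
      rw [hconst]
  · exact le_iSup a m

theorem seq_top {a : ℕ → Sd} (h : (⨆ j, a j) = ⊤) (m : ℕ) : ∃ j, (m : Sd) < a j := by
  by_contra hc
  push Not at hc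
  have := iSup_le hc
  rw [h] at this
  simp at this

theorem compat_step {T : ℝ} {y : ℕ → ℝ → Sd}
    (hR : ∀ j, ∀ t ∈ Icc 0 T, Rec j (y (j + 1)) t (y j t)) (hle : ∀ j, ∀ t ∈ Icc 0 T, y j t ≤ (j : Sd))
    (j : ℕ) {t : ℝ} (ht : t ∈ Icc 0 T) :
    y (j + 1) t = y j t ∨ y (j + 1) t = ((j + 1 : ℕ) : Sd) := by
  rcases le_or_gt (y (j + 1) t) (j : Sd) with h | h
  · exact Or.inl ((hR j t ht).eq_of_le ht.1 h)
  · right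
    apply le_antisymm (hle (j + 1) t ht)
    have := Order.add_one_le_of_lt h
    exact_mod_cast this

section ext
variable {T : ℝ} {y : ℕ → ℝ → Sd}

/-- Entry time of the current holding interval. -/
theorem entry {w : ℝ → Sd} (hw : PC T w) {t : ℝ} (ht : t ∈ Icc 0 T) :
    ∃ s ∈ Icc 0 t, (∀ r ∈ Icc s t, w r = w t) ∧
      ∀ s' ∈ Ico 0 s, ∃ r ∈ Ico s' s, w r ≠ w t := by
  set S : Set ℝ := {s | s ∈ Icc 0 t ∧ ∀ r ∈ Icc s t, w r = w t} with hS
  have htS : t ∈ S := ⟨⟨ht.1, le_rfl⟩, fun r hr => by rw [le_antisymm hr.2 hr.1]⟩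
  have hb : BddBelow S := ⟨0, fun s hs => hs.1.1⟩
  have h0 : 0 ≤ sInf S := le_csInf ⟨t, htS⟩ fun s hs => hs.1.1
  have hst : sInf S ≤ t := csInf_le hb htS
  have hgt : ∀ r, sInf S < r → r ≤ t → w r = w t := by
    intro r h1 h2
    obtain ⟨s, hs, hsr⟩ := exists_lt_of_csInf_lt ⟨t, htS⟩ h1
    exact hs.2 r ⟨hsr.le, h2⟩
  have hself : w (sInf S) = w t := by
    rcases eq_or_lt_of_le hst with h | h
    · rw [h]
    · obtain ⟨b, hb, hbc⟩ := hw.1 (sInf S) ⟨h0, lt_of_lt_of_le h ht.2⟩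
      have h1 : sInf S < min b t := lt_min hb h
      have h2 := min_le_left b t
      have h3 := min_le_right b t
      rw [← hbc ((sInf S + min b t) / 2) ⟨by linarith, by linarith [ht.2]⟩ (by linarith) (by linarith)]
      exact hgt _ (by linarith) (by linarith)
  have hall : ∀ r ∈ Icc (sInf S) t, w r = w t := by
    intro r hr
    rcases eq_or_lt_of_le hr.1 with h | h
    · rw [← h, hself]
    · exact hgt r h hr.2
  refine ⟨sInf S, ⟨h0, hst⟩, hall, fun s' hs' => ?_⟩
  by_contra hc
  push Not at hc
  have : s' ∈ S := by
    refine ⟨⟨hs'.1, hs'.2.le.trans hst⟩, fun r hr => ?_⟩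
    rcases lt_or_ge r (sInf S) with h | h
    · exact hc r ⟨hr.1, h⟩
    · exact hall r ⟨h, hr.2⟩
  exact absurd (csInf_le hb this) (not_le.2 hs'.2)

/-- the limit trajectory -/
def lim (y : ℕ → ℝ → Sd) (t : ℝ) : Sd := ⨆ j, y j t

theorem lim_eq (hR : ∀ j, ∀ t ∈ Icc 0 T, Rec j (y (j + 1)) t (y j t))
    {m : ℕ} {t : ℝ} (ht : t ∈ Icc 0 T) (h : lim y t ≤ (m : Sd)) : lim y t = y m t :=
  have hle : ∀ j, ∀ t ∈ Icc 0 T, y j t ≤ (j : Sd) := fun j t ht => (hR j t ht).le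
  seq_sup (a := fun j => y j t) (fun j => hle j t ht) (fun j => compat_step hR hle j ht) h

theorem lim_eq_of_const {t : ℝ} (hR : ∀ j, ∀ t ∈ Icc 0 T, Rec j (y (j + 1)) t (y j t))
    (ht : t ∈ Icc 0 T) {j : ℕ} {K : Sd} (h : ∀ m, j ≤ m → y m t = K) : lim y t = K := by
  have hle : ∀ j, ∀ t ∈ Icc 0 T, y j t ≤ (j : Sd) := fun j t ht => (hR j t ht).le
  have hm : Monotone fun j => y j t :=
    seq_mono (fun j => hle j t ht) (fun j => compat_step hR hle j ht)
  apply le_antisymm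
  · refine iSup_le fun i => ?_
    rw [← h (max i j) (le_max_right _ _)]
    exact hm (le_max_left _ _)
  · rw [← h j le_rfl]; exact le_iSup (fun j => y j t) j

theorem zero_const (hT : 0 < T) (hR : ∀ j, ∀ t ∈ Icc 0 T, Rec j (y (j + 1)) t (y j t)) {j : ℕ}
    (h0 : y j 0 ≠ 0) : ∀ m, j ≤ m → y m 0 = y j 0 := by
  intro m hm
  induction m, hm using Nat.le_induction with
  | base => rfl
  | succ m hm ih =>
    rcases hR m 0 ⟨le_rfl, hT.le⟩ with ⟨_, h⟩ | ⟨⟨s, hs, h, _⟩, _⟩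
    · exact absurd (ih ▸ h) h0
    · rw [← ih, ← h, le_antisymm hs.2 hs.1]

theorem lim_Rec (hT : 0 < T) (hPC : ∀ j, PC T (y j))
    (hR : ∀ j, ∀ t ∈ Icc 0 T, Rec j (y (j + 1)) t (y j t)) (j : ℕ) {t : ℝ} (ht : t ∈ Icc 0 T) :
    Rec j (lim y) t (y j t) := by
  have hle : ∀ j, ∀ t ∈ Icc 0 T, y j t ≤ (j : Sd) := fun j t ht => (hR j t ht).le
  obtain ⟨s, hs, hconst, hent⟩ := entry (hPC j) ht
  have hsT : s ∈ Icc 0 T := ⟨hs.1, hs.2.trans ht.2⟩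
  have hKj : y j t ≤ (j : Sd) := hle j t ht
  have hafter : ∀ s' ∈ Icc s t, ∀ r ∈ Icc s' t, lim y r ≤ (j : Sd) → lim y r = y j t := by
    intro s' hs' r hr h
    have h1 : s ≤ r := hs'.1.trans hr.1
    rw [lim_eq hR ⟨hs.1.trans h1, hr.2.trans ht.2⟩ h]
    exact hconst r ⟨h1, hr.2⟩
  have main : lim y s = y j t → Rec j (lim y) t (y j t) := fun h =>
    Or.inr ⟨⟨s, hs, h, hafter s ⟨le_rfl, hs.2⟩⟩, hKj⟩
  rcases eq_or_lt_of_le hs.1 with h0 | h0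
  · subst h0
    by_cases hK : y j t = 0
    · by_cases hc : ∃ s ∈ Icc 0 t, lim y s ≤ (j : Sd)
      · obtain ⟨s, hs, h⟩ := hc
        exact Or.inr ⟨⟨s, hs, hafter s hs s ⟨le_rfl, hs.2⟩ h, hafter s hs⟩, hKj⟩
      · push Not at hc
        exact Or.inl ⟨fun s hs => not_le.2 (hc s hs), hK⟩
    · apply main
      have h1 : y j 0 = y j t := hconst 0 ⟨le_rfl, ht.1⟩
      rw [← h1] at hK ⊢
      exact lim_eq_of_const hR hsT (zero_const hT hR hK)
  · apply main
    have key : ∀ m, j ≤ m → y m s = y j t ∧ ∀ s' ∈ Ico 0 s, ∃ r ∈ Ico s' s, y m r ≠ y j t := by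
      intro m hm
      induction m, hm using Nat.le_induction with
      | base => exact ⟨hconst s ⟨le_rfl, hs.2⟩, hent⟩
      | succ m hm ih =>
        have hjm : (j : Sd) ≤ (m : Sd) := by exact_mod_cast hm
        constructor
        · have := hR m s hsT
          rw [ih.1] at this
          rcases this with ⟨h, hz⟩ | ⟨⟨s', hs', hsv, h⟩, _⟩
          · exfalso
            obtain ⟨r, hr, hne⟩ := ih.2 0 ⟨le_rfl, h0⟩
            apply hne
            rw [hz]
            exact (hR m r ⟨hr.1, hr.2.le.trans hsT.2⟩).unique
              (Or.inl ⟨fun q hq => h q ⟨hq.1, hq.2.trans hr.2.le⟩, rfl⟩)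
          · rcases eq_or_lt_of_le hs'.2 with he | hlt
            · rw [← he, hsv]
            · exfalso
              obtain ⟨r, hr, hne⟩ := ih.2 s' ⟨hs'.1, hlt⟩
              apply hne
              exact (hR m r ⟨hs'.1.trans hr.1, hr.2.le.trans hsT.2⟩).unique
                (Or.inr ⟨⟨s', ⟨hs'.1, hr.1⟩, hsv, fun q hq => h q ⟨hq.1, hq.2.trans hr.2.le⟩⟩,
                  hKj.trans hjm⟩)
        · intro s' hs'
          obtain ⟨r, hr, hne⟩ := ih.2 s' hs'
          refine ⟨r, hr, fun he => hne ?_⟩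
          have hr0 : 0 ≤ r := hs'.1.trans hr.1
          rw [← (hR m r ⟨hr0, hr.2.le.trans hsT.2⟩).eq_of_le hr0 (he ▸ hKj.trans hjm), he]
    exact lim_eq_of_const hR hsT fun m hm => (key m hm).1

/-- behaviour of the limit along a one-sided filter on which every `y m` is eventually constant -/
theorem lim_Sl {F : Filter ℝ} [F.NeBot] (hF : ∀ᶠ s in F, s ∈ Icc 0 T)
    (hR : ∀ j, ∀ t ∈ Icc 0 T, Rec j (y (j + 1)) t (y j t)) {c : ℕ → Sd}
    (hc : ∀ m, ∀ᶠ s in F, y m s = c m) :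
    ((⨆ m, c m) = ⊤ → Tendsto (lim y) F (𝓝 ⊤)) ∧
      ∀ n : ℕ, (⨆ m, c m) = (n : Sd) → Sl F (lim y) n := by
  have hle : ∀ j, ∀ t ∈ Icc 0 T, y j t ≤ (j : Sd) := fun j t ht => (hR j t ht).le
  have hc1 : ∀ j : ℕ, c j ≤ (j : Sd) := by
    intro j
    obtain ⟨s, h1, h2⟩ := (hF.and (hc j)).exists
    rw [← h2]; exact hle j s h1
  have hc2 : ∀ j : ℕ, c (j + 1) = c j ∨ c (j + 1) = ((j + 1 : ℕ) : Sd) := by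
    intro j
    obtain ⟨s, h1, h2, h3⟩ := (hF.and ((hc j).and (hc (j + 1)))).exists
    rw [← h2, ← h3]; exact compat_step hR hle j h1
  constructor
  · intro h
    rw [tendsto_top_iff]
    intro m
    obtain ⟨j, hj⟩ := seq_top h m
    filter_upwards [hc j] with s hs
    rw [← hs] at hj
    exact lt_of_lt_of_le hj (le_iSup (fun j => y j s) j)
  · intro n hn m
    filter_upwards [hF, hc (max m n)] with s hs hs2 hle
    have h1 : lim y s ≤ ((max m n : ℕ) : Sd) := hle.trans (by exact_mod_cast le_max_left m n)
    have h2 : (⨆ m, c m) ≤ ((max m n : ℕ) : Sd) := by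
      rw [hn]; exact_mod_cast le_max_right m n
    rw [lim_eq hR hs h1, hs2, ← seq_sup hc1 hc2 h2, hn]

theorem lf_mem (T t : ℝ) : ∀ᶠ s in lf T t, s ∈ Icc 0 T :=
  (lf_iff _ _ _).2 ⟨t - 1, by linarith, fun _ hs _ _ => hs⟩

theorem rf_mem (T t : ℝ) : ∀ᶠ s in rf T t, s ∈ Icc 0 T :=
  (rf_iff _ _ _).2 ⟨t + 1, by linarith, fun _ hs _ _ => hs⟩

theorem lim_memE (hT : 0 < T) (hPC : ∀ j, PC T (y j))
    (hR : ∀ j, ∀ t ∈ Icc 0 T, Rec j (y (j + 1)) t (y j t)) : memE T (lim y) := by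
  have hle : ∀ j, ∀ t ∈ Icc 0 T, y j t ≤ (j : Sd) := fun j t ht => (hR j t ht).le
  have h0T : (0 : ℝ) ∈ Icc 0 T := ⟨le_rfl, hT.le⟩
  have hzero : lim y 0 ≠ ⊤ := by
    intro h
    obtain ⟨j, hj⟩ := seq_top h 0
    have := lim_eq_of_const hR h0T (zero_const hT hR (j := j) (by rintro h; simp [h] at hj))
    rw [h] at this
    have h2 := hle j 0 h0T
    rw [← this] at h2
    simp at h2
  refine ⟨⟨fun t ht => ?_, fun t ht => ?_⟩, hzero, fun t ht htop => ?_⟩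
  · rcases eq_or_lt_of_le ht.2 with rfl | hlt
    · refine Or.inl ((tendsto_top_iff _ _).2 fun m => (rf_iff _ _ _).2 ⟨t + 1, by linarith, ?_⟩)
      intro s hs h1
      exact absurd hs.2 (not_le.2 h1)
    · have := rf_neBot (T := T) ⟨ht.1, hlt⟩
      have hc : ∀ m, ∀ᶠ s in rf T t, y m s = y m t := fun m =>
        (rf_iff _ _ _).2 ((hPC m).1 t ⟨ht.1, hlt⟩)
      obtain ⟨h1, h2⟩ := lim_Sl (rf_mem T t) hR hc
      by_cases htop : lim y t = ⊤
      · exact Or.inl (h1 htop)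
      · obtain ⟨n, hn⟩ := ENat.ne_top_iff_exists.1 htop
        rcases Sl_cases (h2 n hn.symm) with h | h | h
        · exact Or.inr (Or.inl ⟨n, h, hn.symm⟩)
        · exact Or.inl h
        · exact Or.inr (Or.inr ⟨n, h, hn.symm⟩)
  · have := lf_neBot ht
    have : ∀ m, ∃ c, ∀ᶠ s in lf T t, y m s = c := by
      intro m
      obtain ⟨a, ha, c, hc⟩ := (hPC m).2 t ht
      exact ⟨c, (lf_iff _ _ _).2 ⟨a, ha, hc⟩⟩
    choose c hc using this
    obtain ⟨h1, h2⟩ := lim_Sl (lf_mem T t) hR hc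
    by_cases htop : (⨆ m, c m) = ⊤
    · exact Or.inl ⟨_, h1 htop⟩
    · obtain ⟨n, hn⟩ := ENat.ne_top_iff_exists.1 htop
      exact (softLeftLim_iff _ _ _).2 ⟨n, h2 n hn.symm⟩
  · set S : Set ℝ := {s | s ∈ Icc 0 t ∧ lim y s ≠ ⊤} with hS
    have hσdef : sigmaInf (lim y) t = sSup S := rfl
    rw [hσdef]
    set σ := sSup S with hσ
    have hne : S.Nonempty := ⟨0, ⟨le_rfl, ht.1.le⟩, hzero⟩
    have hbdd : BddAbove S := ⟨t, fun s hs => hs.1.2⟩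
    have hσt : σ ≤ t := csSup_le hne fun s hs => hs.1.2
    have hσ0 : 0 ≤ σ := le_csSup hbdd ⟨⟨le_rfl, ht.1.le⟩, hzero⟩
    have htT : t ∈ Icc 0 T := ⟨ht.1.le, ht.2⟩
    have hσT : σ ∈ Icc 0 T := ⟨hσ0, hσt.trans ht.2⟩
    have hafter : ∀ r, σ < r → r ≤ t → lim y r = ⊤ := by
      intro r h1 h2
      by_contra hc
      exact absurd (le_csSup hbdd ⟨⟨hσ0.trans h1.le, h2⟩, hc⟩) (not_le.2 h1)
    have hyσ : ∀ m, y m t = y m σ := by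
      intro m
      refine (lim_Rec hT hPC hR m htT).unique ?_
      refine (lim_Rec hT hPC hR m hσT).extend hσ0 hσt fun r h1 h2 h3 => ?_
      rw [hafter r h1 h2] at h3
      simp at h3
    have hσtop : lim y σ = ⊤ := by
      rw [← htop]; unfold lim; simp only [hyσ]
    have hσpos : 0 < σ := lt_of_le_of_ne hσ0 fun h => hzero (h ▸ hσtop)
    refine ⟨hσpos, hσtop, ?_⟩
    have := lf_neBot (T := T) ⟨hσpos, hσT.2⟩
    have hc : ∀ m, ∀ᶠ s in lf T σ, y m s = y m σ := by
      intro m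
      obtain ⟨a, ha, c, hc⟩ := (hPC m).2 σ ⟨hσpos, hσT.2⟩
      refine (lf_iff _ _ _).2 ⟨a, ha, fun s hs h1 h2 => ?_⟩
      refine Rec.unique ?_ (lim_Rec hT hPC hR m hσT)
      refine (lim_Rec hT hPC hR m hs).extend hs.1 h2.le fun r hr1 hr2 hr3 => ?_
      rcases eq_or_lt_of_le hr2 with rfl | hr
      · rw [hσtop] at hr3; simp at hr3
      · have hrT : r ∈ Icc 0 T := ⟨hs.1.trans hr1.le, hr2.trans hσT.2⟩
        rw [lim_eq hR hrT hr3, hc s hs h1 h2]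
        exact hc r hrT (h1.trans hr1) hr
    exact (lim_Sl (lf_mem T σ) hR hc).1 hσtop

end ext
end Soft

namespace Soft

/-- bi-Lipschitz form of a time change with logarithmic slope bound `a` -/
def TC (T : ℝ) (l : ℝ → ℝ) (a : ℝ) : Prop :=
  l 0 = 0 ∧ l T = T ∧ ∀ s ∈ Icc 0 T, ∀ t ∈ Icc 0 T, s ≤ t →
    Real.exp (-a) * (t - s) ≤ l t - l s ∧ l t - l s ≤ Real.exp a * (t - s)

section tc
variable {T : ℝ} {l l' : ℝ → ℝ} {a b : ℝ}

theorem TC.strictMono (h : TC T l a) : StrictMonoOn l (Icc 0 T) := by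
  intro s hs t ht hst
  have h1 := (h.2.2 s hs t ht hst.le).1
  have h2 : 0 < Real.exp (-a) * (t - s) := mul_pos (Real.exp_pos _) (by linarith)
  linarith

theorem TC.mapsTo (hT : 0 < T) (h : TC T l a) {t : ℝ} (ht : t ∈ Icc 0 T) : l t ∈ Icc 0 T := by
  have h0 := h.strictMono.monotoneOn (a := 0) ⟨le_rfl, hT.le⟩ ht ht.1
  have h1 := h.strictMono.monotoneOn (b := T) ht ⟨hT.le, le_rfl⟩ ht.2
  rw [h.1] at h0
  rw [h.2.1] at h1
  exact ⟨h0, h1⟩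

theorem TC.cont (h : TC T l a) : ContinuousOn l (Icc 0 T) := by
  have : LipschitzOnWith (Real.toNNReal (Real.exp a)) l (Icc 0 T) := by
    apply LipschitzOnWith.of_dist_le_mul
    have key : ∀ s ∈ Icc 0 T, ∀ t ∈ Icc 0 T, s ≤ t → |l t - l s| ≤ Real.exp a * |t - s| := by
      intro s hs t ht hst
      have h1 := h.2.2 s hs t ht hst
      have h2 : 0 ≤ Real.exp (-a) * (t - s) := mul_nonneg (Real.exp_pos _).le (by linarith)
      rw [abs_of_nonneg (by linarith), abs_of_nonneg (by linarith)]
      exact h1.2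
    intro s hs t ht
    rw [Real.coe_toNNReal _ (Real.exp_pos _).le, Real.dist_eq, Real.dist_eq]
    rcases le_total t s with h | h
    · exact key t ht s hs h
    · rw [abs_sub_comm (l s), abs_sub_comm s]; exact key s hs t ht h
  exact this.continuousOn

theorem TC.surj (hT : 0 < T) (h : TC T l a) {t : ℝ} (ht : t ∈ Icc 0 T) :
    ∃ s ∈ Icc 0 T, l s = t := by
  have := intermediate_value_Icc hT.le h.cont
  rw [h.1, h.2.1] at this
  exact this ht

theorem TC.timeChange (hT : 0 < T) (h : TC T l a) : TimeChange T l :=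
  ⟨h.1, h.2.1, h.cont, h.strictMono, fun _ ht => h.mapsTo hT ht⟩

theorem TC.log (h : TC T l a) : ∀ s ∈ Icc 0 T, ∀ t ∈ Icc 0 T, s < t →
    |Real.log ((l t - l s) / (t - s))| ≤ a := by
  intro s hs t ht hst
  obtain ⟨h1, h2⟩ := h.2.2 s hs t ht hst.le
  have hp : 0 < t - s := by linarith
  have hq : 0 < (l t - l s) / (t - s) := div_pos (by linarith [h.strictMono hs ht hst]) hp
  rw [abs_le]
  constructor
  · rw [Real.le_log_iff_exp_le hq, le_div_iff₀ hp]; exact h1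
  · rw [Real.log_le_iff_le_exp hq, div_le_iff₀ hp]; exact h2

theorem TC.of (h : TimeChange T l) (hl : ∀ s ∈ Icc 0 T, ∀ t ∈ Icc 0 T, s < t →
    |Real.log ((l t - l s) / (t - s))| ≤ a) : TC T l a := by
  refine ⟨h.1, h.2.1, fun s hs t ht hst => ?_⟩
  rcases eq_or_lt_of_le hst with rfl | hst
  · simp
  have hp : 0 < t - s := by linarith
  have hq : 0 < (l t - l s) / (t - s) := div_pos (by linarith [h.2.2.2.1 hs ht hst]) hp
  have := hl s hs t ht hst
  rw [abs_le, Real.le_log_iff_exp_le hq, le_div_iff₀ hp, Real.log_le_iff_le_exp hq,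
    div_le_iff₀ hp] at this
  exact this

theorem TC.mono (h : TC T l a) (hab : a ≤ b) : TC T l b := by
  refine ⟨h.1, h.2.1, fun s hs t ht hst => ?_⟩
  obtain ⟨h1, h2⟩ := h.2.2 s hs t ht hst
  have hp : 0 ≤ t - s := by linarith
  have h3 : Real.exp (-b) ≤ Real.exp (-a) := Real.exp_le_exp.2 (by linarith)
  have h4 : Real.exp a ≤ Real.exp b := Real.exp_le_exp.2 hab
  constructor <;> nlinarith

theorem TC.comp (hT : 0 < T) (h' : TC T l' b) (h : TC T l a) :
    TC T (fun t => l' (l t)) (a + b) := by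
  refine ⟨by simp [h.1, h'.1], by simp [h.2.1, h'.2.1], fun s hs t ht hst => ?_⟩
  obtain ⟨h1, h2⟩ := h.2.2 s hs t ht hst
  obtain ⟨h3, h4⟩ := h'.2.2 _ (h.mapsTo hT hs) _ (h.mapsTo hT ht)
    (h.strictMono.monotoneOn hs ht hst)
  rw [neg_add, Real.exp_add, Real.exp_add]
  have e1 := Real.exp_pos b
  have e2 := Real.exp_pos (-b)
  constructor
  · calc _ = Real.exp (-b) * (Real.exp (-a) * (t - s)) := by ring
      _ ≤ Real.exp (-b) * (l t - l s) := by gcongr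
      _ ≤ _ := h3
  · calc _ ≤ Real.exp b * (l t - l s) := h4
      _ ≤ Real.exp b * (Real.exp a * (t - s)) := by gcongr
      _ = _ := by ring

theorem TC.inv (hT : 0 < T) (h : TC T l a) : ∃ M, TC T M a ∧ (∀ t ∈ Icc 0 T, l (M t) = t) ∧
    ∀ t ∈ Icc 0 T, M (l t) = t := by
  have : ∀ t, ∃ s, t ∈ Icc 0 T → s ∈ Icc 0 T ∧ l s = t := by
    intro t
    by_cases ht : t ∈ Icc 0 T
    · obtain ⟨s, hs, h⟩ := h.surj hT ht
      exact ⟨s, fun _ => ⟨hs, h⟩⟩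
    · exact ⟨0, fun h => absurd h ht⟩
  choose M hM using this
  have hinv : ∀ t ∈ Icc 0 T, M (l t) = t := fun t ht => by
    have := hM (l t) (h.mapsTo hT ht)
    exact h.strictMono.injOn this.1 ht this.2
  refine ⟨M, ⟨?_, ?_, fun s hs t ht hst => ?_⟩, fun t ht => (hM t ht).2, hinv⟩
  · have := hinv 0 ⟨le_rfl, hT.le⟩
    rwa [h.1] at this
  · have := hinv T ⟨hT.le, le_rfl⟩
    rwa [h.2.1] at this
  · obtain ⟨hs1, hs2⟩ := hM s hs
    obtain ⟨ht1, ht2⟩ := hM t ht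
    have hle : M s ≤ M t := by
      rw [← h.strictMono.le_iff_le hs1 ht1, hs2, ht2]; exact hst
    obtain ⟨h1, h2⟩ := h.2.2 _ hs1 _ ht1 hle
    rw [hs2, ht2] at h1 h2
    have e : Real.exp (-a) * Real.exp a = 1 := by rw [← Real.exp_add]; simp
    have e1 := Real.exp_pos a
    have e2 := Real.exp_pos (-a)
    constructor
    · calc _ ≤ Real.exp (-a) * (Real.exp a * (M t - M s)) := by gcongr
        _ = (Real.exp (-a) * Real.exp a) * (M t - M s) := by ring
        _ = _ := by rw [e, one_mul]
    · calc _ = (Real.exp (-a) * Real.exp a) * (M t - M s) := by rw [e, one_mul]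
        _ = Real.exp a * (Real.exp (-a) * (M t - M s)) := by ring
        _ ≤ _ := by gcongr

theorem Rec.comp (hT : 0 < T) (h : TC T l a) {m : ℕ} {x : ℝ → Sd} {t : ℝ} (ht : t ∈ Icc 0 T)
    {v : Sd} (hr : Rec m x (l t) v) : Rec m (fun t => x (l t)) t v := by
  have hmono := h.strictMono.monotoneOn
  rcases hr with ⟨hr, rfl⟩ | ⟨⟨s, hs, hsv, hr⟩, hv⟩
  · refine Or.inl ⟨fun s hs => ?_, rfl⟩
    have hsT : s ∈ Icc 0 T := ⟨hs.1, hs.2.trans ht.2⟩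
    exact hr (l s) ⟨(h.mapsTo hT hsT).1, hmono hsT ht hs.2⟩
  · obtain ⟨s', hs', rfl⟩ := h.surj hT (t := s) ⟨hs.1, hs.2.trans (h.mapsTo hT ht).2⟩
    refine Or.inr ⟨⟨s', ⟨hs'.1, (h.strictMono.le_iff_le hs' ht).1 hs.2⟩, hsv, fun r hr1 hr2 => ?_⟩,
      hv⟩
    have hrT : r ∈ Icc 0 T := ⟨hs'.1.trans hr1.1, hr1.2.trans ht.2⟩
    exact hr (l r) ⟨hmono hs' hrT hr1.1, hmono hrT ht hr1.2⟩ hr2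

theorem PC.comp (hT : 0 < T) (h : TC T l a) {w : ℝ → Sd} (hw : PC T w) :
    PC T (fun t => w (l t)) := by
  have hM := h.strictMono
  have h0 : (0 : ℝ) ∈ Icc 0 T := ⟨le_rfl, hT.le⟩
  have hTT : T ∈ Icc 0 T := ⟨hT.le, le_rfl⟩
  constructor
  · intro t ht
    have htT : t ∈ Icc 0 T := ⟨ht.1, ht.2.le⟩
    have h2 : l t < T := by have := hM htT hTT ht.2; rwa [h.2.1] at this
    obtain ⟨b, hb, hbc⟩ := hw.1 (l t) ⟨(h.mapsTo hT htT).1, h2⟩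
    obtain ⟨q, hq, hqe⟩ := h.surj hT (t := min b T)
      ⟨le_min ((h.mapsTo hT htT).1.trans hb.le) hT.le, min_le_right _ _⟩
    refine ⟨q, (hM.lt_iff_lt htT hq).1 (by rw [hqe]; exact lt_min hb h2), fun s hs h3 h4 => ?_⟩
    refine hbc (l s) (h.mapsTo hT hs) (hM htT hs h3) ?_
    have := hM hs hq h4
    rw [hqe] at this
    exact lt_of_lt_of_le this (min_le_left _ _)
  · intro t ht
    have htT : t ∈ Icc 0 T := ⟨ht.1.le, ht.2⟩
    have h2 : 0 < l t := by have := hM h0 htT ht.1; rwa [h.1] at this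
    obtain ⟨b, hb, c, hbc⟩ := hw.2 (l t) ⟨h2, (h.mapsTo hT htT).2⟩
    obtain ⟨q, hq, hqe⟩ := h.surj hT (t := max b 0)
      ⟨le_max_right _ _, max_le (hb.le.trans (h.mapsTo hT htT).2) hT.le⟩
    refine ⟨q, (hM.lt_iff_lt hq htT).1 (by rw [hqe]; exact max_lt hb h2), c, fun s hs h3 h4 => ?_⟩
    refine hbc (l s) (h.mapsTo hT hs) ?_ (hM hs htT h4)
    have := hM hq hs h3
    rw [hqe] at this
    exact lt_of_le_of_lt (le_max_left _ _) this

end tc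

theorem sval_mem (k : Sd) : 0 ≤ sval k ∧ sval k ≤ 1 := by
  unfold sval
  split_ifs
  · simp
  · have : (0 : ℝ) ≤ (k.toNat : ℝ) := Nat.cast_nonneg _
    exact ⟨by positivity, by rw [div_le_one (by positivity)]; linarith⟩

theorem sdist_le_one (k j : Sd) : sdist k j ≤ 1 := by
  unfold sdist
  have h1 := sval_mem k
  have h2 := sval_mem j
  rw [abs_le]; constructor <;> linarith

theorem sdist_eq {m : ℕ} {p q : Sd} (hp : p ≤ (m : Sd)) (hq : q ≤ (m : Sd))
    (h : sdist p q < 1 / ((m : ℝ) + 1) ^ 2) : p = q := by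
  obtain ⟨p, rfl⟩ := ENat.ne_top_iff_exists.1 (ne_top_of_le_ne_top (ENat.natCast_ne_top m) hp)
  obtain ⟨q, rfl⟩ := ENat.ne_top_iff_exists.1 (ne_top_of_le_ne_top (ENat.natCast_ne_top m) hq)
  have hp' : (p : ℝ) ≤ m := by exact_mod_cast hp
  have hq' : (q : ℝ) ≤ m := by exact_mod_cast hq
  unfold sdist sval at h
  simp only [ENat.natCast_ne_top, if_false, ENat.toNat_natCast] at h
  by_contra hne
  have hne' : (p : ℤ) ≠ q := by
    intro h; apply hne; have : p = q := by exact_mod_cast h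
    rw [this]
  have h1 : (1 : ℝ) ≤ |(q : ℝ) - p| := by
    have : (1 : ℤ) ≤ |(q : ℤ) - p| := Int.one_le_abs (sub_ne_zero.2 hne'.symm)
    exact_mod_cast this
  have hp0 : (0 : ℝ) ≤ p := Nat.cast_nonneg _
  have hq0 : (0 : ℝ) ≤ q := Nat.cast_nonneg _
  have e : 1 / ((p : ℝ) + 1) - 1 / ((q : ℝ) + 1) = (q - p) / ((p + 1) * (q + 1)) := by
    field_simp; ring
  rw [e, abs_div, abs_of_pos (by positivity : (0 : ℝ) < (p + 1) * (q + 1)),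
    div_lt_div_iff₀ (by positivity) (by positivity)] at h
  nlinarith [mul_le_mul (add_le_add_left hp' 1) (add_le_add_left hq' 1) (by positivity) (by positivity), sq_nonneg ((m : ℝ) + 1)]

theorem dS_bddBelow (T : ℝ) (hT : 0 < T) (x y : ℝ → Sd) : ∀ a ∈ {a : ℝ | ∃ l, TimeChange T l ∧
    (∀ t ∈ Set.Icc 0 T, sdist (x t) (y (l t)) ≤ a) ∧
    ∀ s ∈ Set.Icc 0 T, ∀ t ∈ Set.Icc 0 T, s < t → |Real.log ((l t - l s) / (t - s))| ≤ a}, 0 ≤ a := by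
  rintro a ⟨l, _, h, _⟩
  exact (abs_nonneg _).trans (h 0 ⟨le_rfl, hT.le⟩)

theorem one_mem_dS (T : ℝ) (x y : ℝ → Sd) : (1 : ℝ) ∈ {a : ℝ | ∃ l, TimeChange T l ∧
    (∀ t ∈ Set.Icc 0 T, sdist (x t) (y (l t)) ≤ a) ∧
    ∀ s ∈ Set.Icc 0 T, ∀ t ∈ Set.Icc 0 T, s < t → |Real.log ((l t - l s) / (t - s))| ≤ a} := by
  refine ⟨fun t => t, ⟨rfl, rfl, continuousOn_id, fun _ _ _ _ h => h, fun _ h => h⟩,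
    fun t _ => sdist_le_one _ _, fun s _ t _ hst => ?_⟩
  rw [div_self (by linarith)]; simp

theorem dS_nonneg {T : ℝ} (hT : 0 < T) (x y : ℝ → Sd) : 0 ≤ dS T x y :=
  Real.sInf_nonneg (dS_bddBelow T hT x y)

theorem dS_le_one {T : ℝ} (hT : 0 < T) (x y : ℝ → Sd) : dS T x y ≤ 1 :=
  csInf_le ⟨0, dS_bddBelow T hT x y⟩ (one_mem_dS T x y)

theorem dS_le {T : ℝ} (hT : 0 < T) {x y : ℝ → Sd} {l : ℝ → ℝ} {b : ℝ} (hb : 0 ≤ b)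
    (h : TC T l b) (hxy : ∀ t ∈ Icc 0 T, x t = y (l t)) : dS T x y ≤ b := by
  refine csInf_le ⟨0, dS_bddBelow T hT x y⟩ ⟨l, h.timeChange hT, fun t ht => ?_, h.log⟩
  rw [hxy t ht]; simpa [sdist] using hb

theorem dS_lt {T : ℝ} {x y : ℝ → Sd} {b : ℝ} (h : dS T x y < b) :
    ∃ l, TC T l b ∧ ∀ t ∈ Icc 0 T, sdist (x t) (y (l t)) < b := by
  obtain ⟨a, ⟨l, h1, h2, h3⟩, hab⟩ := exists_lt_of_csInf_lt ⟨1, one_mem_dS T x y⟩ h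
  exact ⟨l, (TC.of h1 h3).mono hab.le, fun t ht => lt_of_le_of_lt (h2 t ht) hab⟩

theorem dE_summable {T : ℝ} (hT : 0 < T) (x y : ℝ → Sd) :
    Summable fun m : ℕ => (1 / 2 : ℝ) ^ (m + 1) * dS T (Rm T m x) (Rm T m y) := by
  refine Summable.of_nonneg_of_le (f := fun m : ℕ => (1 / 2 : ℝ) ^ (m + 1)) ?_ ?_ ?_
  · intro m; exact mul_nonneg (by positivity) (dS_nonneg hT _ _)
  · intro m; exact mul_le_of_le_one_right (by positivity) (dS_le_one hT _ _)
  · exact (summable_nat_add_iff 1).2 summable_geometric_two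

theorem dE_nonneg {T : ℝ} (hT : 0 < T) (x y : ℝ → Sd) : 0 ≤ dE T x y :=
  tsum_nonneg fun m => mul_nonneg (by positivity) (dS_nonneg hT _ _)

theorem dS_lt_of_dE {T : ℝ} (hT : 0 < T) {x y : ℝ → Sd} (m : ℕ) {b : ℝ}
    (h : dE T x y < (1 / 2 : ℝ) ^ (m + 1) * b) : dS T (Rm T m x) (Rm T m y) < b := by
  have := (dE_summable hT x y).le_tsum m
    (fun j _ => mul_nonneg (by positivity) (dS_nonneg hT _ _))
  have h2 : (1 / 2 : ℝ) ^ (m + 1) * dS T (Rm T m x) (Rm T m y) < (1 / 2 : ℝ) ^ (m + 1) * b :=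
    lt_of_le_of_lt this h
  exact lt_of_mul_lt_mul_left h2 (by positivity)

theorem dE_le {T : ℝ} (hT : 0 < T) {x y : ℝ → Sd} (m : ℕ) {b : ℝ} (hb : 0 ≤ b)
    (h : ∀ j ≤ m, dS T (Rm T j x) (Rm T j y) ≤ b) : dE T x y ≤ b + (1 / 2 : ℝ) ^ (m + 1) := by
  have hgeo : ∑' j : ℕ, (1 / 2 : ℝ) ^ (j + 1) = 1 := by
    simp only [pow_succ, tsum_mul_right, tsum_geometric_two]; norm_num
  have hsg : Summable fun j : ℕ => (1 / 2 : ℝ) ^ (j + 1) :=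
    (summable_nat_add_iff 1).2 summable_geometric_two
  unfold dE
  rw [← (dE_summable hT x y).sum_add_tsum_nat_add (m + 1)]
  apply add_le_add
  · calc _ ≤ ∑ j ∈ Finset.range (m + 1), (1 / 2 : ℝ) ^ (j + 1) * b := by
          refine Finset.sum_le_sum fun j hj => ?_
          exact mul_le_mul_of_nonneg_left (h j (Nat.lt_succ_iff.1 (Finset.mem_range.1 hj)))
            (by positivity)
      _ = (∑ j ∈ Finset.range (m + 1), (1 / 2 : ℝ) ^ (j + 1)) * b := by rw [Finset.sum_mul]
      _ ≤ 1 * b := by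
          refine mul_le_mul_of_nonneg_right ?_ hb
          exact (hsg.sum_le_tsum _ fun j _ => by positivity).trans hgeo.le
      _ = b := one_mul b
  · calc _ ≤ ∑' j : ℕ, (1 / 2 : ℝ) ^ (m + 1) * (1 / 2 : ℝ) ^ (j + 1) := by
          refine Summable.tsum_le_tsum (fun j => ?_)
            ((summable_nat_add_iff (m + 1)).2 (dE_summable hT x y)) (hsg.mul_left _)
          rw [← pow_add, show m + 1 + (j + 1) = j + (m + 1) + 1 by ring]
          exact mul_le_of_le_one_right (by positivity) (dS_le_one hT _ _)
      _ = _ := by rw [tsum_mul_left, hgeo, mul_one]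

theorem Rm_Rm {T : ℝ} {x : ℝ → Sd} (hx : ∀ t ∈ Ioc 0 T, softLeftLim T x t) {j m : ℕ} (hjm : j ≤ m)
    {t : ℝ} (ht : t ∈ Icc 0 T) : Rec j (Rm T m x) t (Rm T j x t) :=
  Rec.trans hjm (fun _ hs => Rm_spec hx m ⟨hs.1, hs.2.trans ht.2⟩) (Rm_spec hx j ht)

theorem Rm_match {T : ℝ} (hT : 0 < T) {x z : ℝ → Sd} (hx : ∀ t ∈ Ioc 0 T, softLeftLim T x t)
    (hz : ∀ t ∈ Ioc 0 T, softLeftLim T z t) {m : ℕ} {l : ℝ → ℝ} {b : ℝ} (hl : TC T l b)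
    (h : ∀ t ∈ Icc 0 T, Rm T m x t = Rm T m z (l t)) :
    ∀ j ≤ m, ∀ t ∈ Icc 0 T, Rm T j x t = Rm T j z (l t) := by
  intro j hj t ht
  have h1 := Rm_Rm hx hj ht
  have h2 := Rec.comp hT hl ht (Rm_Rm hz hj (hl.mapsTo hT ht))
  exact h1.unique (h2.congr fun s hs => (h s ⟨hs.1, hs.2.trans ht.2⟩).symm)

theorem dE_le_of_match {T : ℝ} (hT : 0 < T) {x z : ℝ → Sd}
    (hx : ∀ t ∈ Ioc 0 T, softLeftLim T x t)
    (hz : ∀ t ∈ Ioc 0 T, softLeftLim T z t) {m : ℕ} {l : ℝ → ℝ} {b : ℝ} (hb : 0 ≤ b)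
    (hl : TC T l b) (h : ∀ t ∈ Icc 0 T, Rm T m x t = Rm T m z (l t)) :
    dE T x z ≤ b + (1 / 2 : ℝ) ^ (m + 1) :=
  dE_le hT m hb fun j hj => dS_le hT hb hl (Rm_match hT hx hz hl h j hj)

theorem match_of_dE {T : ℝ} (hT : 0 < T) {x z : ℝ → Sd}
    (hx : ∀ t ∈ Ioc 0 T, softLeftLim T x t)
    (hz : ∀ t ∈ Ioc 0 T, softLeftLim T z t) (m : ℕ) {b : ℝ}
    (h : dE T x z < (1 / 2 : ℝ) ^ (m + 1) * min b (1 / ((m : ℝ) + 1) ^ 2)) :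
    ∃ l, TC T l b ∧ ∀ t ∈ Icc 0 T, Rm T m x t = Rm T m z (l t) := by
  obtain ⟨l, hl, h2⟩ := dS_lt (dS_lt_of_dE hT m h)
  refine ⟨l, hl.mono (min_le_left _ _), fun t ht => ?_⟩
  exact sdist_eq (Rm_spec hx m ht).le (Rm_spec hz m (hl.mapsTo hT ht)).le
    (lt_of_lt_of_le (h2 t ht) (min_le_right _ _))

end Soft

namespace Soft

/-- `Lc l k j = l (k+j-1) ∘ ⋯ ∘ l k` -/
def Lc (l : ℕ → ℝ → ℝ) : ℕ → ℕ → ℝ → ℝ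
  | _, 0, t => t
  | k, j + 1, t => Lc l (k + 1) j (l k t)

theorem Lc_succ (l : ℕ → ℝ → ℝ) (j : ℕ) : ∀ (k : ℕ) (t : ℝ),
    Lc l k (j + 1) t = l (k + j) (Lc l k j t) := by
  induction j with
  | zero => intro k t; rfl
  | succ j ih =>
    intro k t
    change Lc l (k + 1) (j + 1) (l k t) = l (k + (j + 1)) (Lc l (k + 1) j (l k t))
    rw [ih, show k + 1 + j = k + (j + 1) by ring]

theorem TC_id (T : ℝ) : TC T (fun t => t) 0 := by
  refine ⟨rfl, rfl, fun s _ t _ _ => ?_⟩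
  simp

theorem Lc_TC {T : ℝ} (hT : 0 < T) {l : ℕ → ℝ → ℝ} (hl : ∀ k, TC T (l k) ((1 / 2) ^ k)) (j : ℕ) :
    ∀ k, TC T (Lc l k j) (2 * (1 / 2) ^ k) := by
  induction j with
  | zero => intro k; exact (TC_id T).mono (by positivity)
  | succ j ih =>
    intro k
    have := (ih (k + 1)).comp hT (hl k)
    refine this.mono (le_of_eq ?_)
    rw [pow_succ]; ring

theorem TC.near {T : ℝ} {l : ℝ → ℝ} {a : ℝ} (ha : 0 ≤ a) (ha1 : a ≤ 1) (h : TC T l a)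
    {t : ℝ} (ht : t ∈ Icc 0 T) : |l t - t| ≤ 2 * a * T := by
  have h0 : (0 : ℝ) ∈ Icc 0 T := ⟨le_rfl, ht.1.trans ht.2⟩
  obtain ⟨h1, h2⟩ := h.2.2 0 h0 t ht ht.1
  rw [h.1, sub_zero, sub_zero] at h1 h2
  have e1 := Real.abs_exp_sub_one_le (x := a) (by rw [abs_of_nonneg ha]; exact ha1)
  rw [abs_of_nonneg ha] at e1
  have e1' := (abs_le.1 e1).2
  have e2 := Real.add_one_le_exp (-a)
  have h3 : Real.exp a * t ≤ (1 + 2 * a) * t := mul_le_mul_of_nonneg_right (by linarith) ht.1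
  have h4 : (-a + 1) * t ≤ Real.exp (-a) * t := mul_le_mul_of_nonneg_right e2 ht.1
  have h5 : a * t ≤ a * T := mul_le_mul_of_nonneg_left ht.2 ha
  have h6 : 0 ≤ a * t := mul_nonneg ha ht.1
  rw [abs_le]
  constructor <;> nlinarith

theorem exists_lim_TC {T : ℝ} (hT : 0 < T) {l : ℕ → ℝ → ℝ} (hl : ∀ k, TC T (l k) ((1 / 2) ^ k)) :
    ∃ Λ : ℕ → ℝ → ℝ, (∀ k, TC T (Λ k) (2 * (1 / 2) ^ k)) ∧
      ∀ k, ∀ t ∈ Icc 0 T, Λ (k + 1) (l k t) = Λ k t := by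
  have hc : ∀ k t, ∃ L, t ∈ Icc 0 T → Tendsto (fun j => Lc l k j t) atTop (𝓝 L) := by
    intro k t
    by_cases ht : t ∈ Icc 0 T
    · have : CauchySeq fun j => Lc l k j t := by
        refine cauchySeq_of_le_geometric (1 / 2) (2 * (1 / 2) ^ k * T) (by norm_num) fun j => ?_
        rw [Lc_succ, dist_comm, Real.dist_eq]
        refine ((hl (k + j)).near (by positivity) (pow_le_one₀ (by norm_num) (by norm_num))
          ((Lc_TC hT hl j k).mapsTo hT ht)).trans (le_of_eq ?_)
        rw [pow_add]; ring
      obtain ⟨L, hL⟩ := cauchySeq_tendsto_of_complete this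
      exact ⟨L, fun _ => hL⟩
    · exact ⟨0, fun h => absurd h ht⟩
  choose Λ hΛ using hc
  have h0 : (0 : ℝ) ∈ Icc 0 T := ⟨le_rfl, hT.le⟩
  have hTT : T ∈ Icc 0 T := ⟨hT.le, le_rfl⟩
  refine ⟨Λ, fun k => ⟨?_, ?_, fun s hs t ht hst => ⟨?_, ?_⟩⟩, fun k t ht => ?_⟩
  · refine tendsto_nhds_unique (hΛ k 0 h0) ?_
    simp only [(Lc_TC hT hl _ k).1]; exact tendsto_const_nhds
  · refine tendsto_nhds_unique (hΛ k T hTT) ?_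
    simp only [(Lc_TC hT hl _ k).2.1]; exact tendsto_const_nhds
  · exact ge_of_tendsto' ((hΛ k t ht).sub (hΛ k s hs))
      fun j => ((Lc_TC hT hl j k).2.2 s hs t ht hst).1
  · exact le_of_tendsto' ((hΛ k t ht).sub (hΛ k s hs))
      fun j => ((Lc_TC hT hl j k).2.2 s hs t ht hst).2
  · have h1 := hΛ (k + 1) (l k t) ((hl k).mapsTo hT ht)
    have h2 := (tendsto_add_atTop_iff_nat 1).2 (hΛ k t ht)
    exact tendsto_nhds_unique h1 h2

theorem complete {T : ℝ} (hT : 0 < T) (u : ℕ → ℝ → Sd) (hu : ∀ n, memE T (u n))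
    (hC : ∀ ε > (0:ℝ), ∃ N : ℕ, ∀ p ≥ N, ∀ q ≥ N, dE T (u p) (u q) < ε) :
    ∃ x : ℝ → Sd, memE T x ∧ Tendsto (fun n => dE T (u n) x) atTop (𝓝 0) := by
  have hsoft : ∀ n, ∀ t ∈ Ioc 0 T, softLeftLim T (u n) t := fun n => (hu n).1.2
  have hN : ∀ k : ℕ, ∃ N : ℕ, ∀ p ≥ N, ∀ q ≥ N, ∃ l, TC T l ((1 / 2) ^ k) ∧
      ∀ t ∈ Icc 0 T, Rm T k (u p) t = Rm T k (u q) (l t) := by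
    intro k
    obtain ⟨N, h⟩ := hC ((1 / 2 : ℝ) ^ (k + 1) * min ((1 / 2) ^ k) (1 / ((k : ℝ) + 1) ^ 2))
      (mul_pos (by positivity) (lt_min (by positivity) (by positivity)))
    exact ⟨N, fun p hp q hq => match_of_dE hT (hsoft p) (hsoft q) k (h p hp q hq)⟩
  choose N hN using hN
  let n : ℕ → ℕ := fun k => ∑ i ∈ Finset.range (k + 1), N i
  have hn : ∀ k, N k ≤ n k := fun k =>
    Finset.single_le_sum (f := N) (fun _ _ => Nat.zero_le _) (Finset.self_mem_range_succ k)
  have hn' : ∀ k, N k ≤ n (k + 1) := fun k =>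
    Finset.single_le_sum (f := N) (fun _ _ => Nat.zero_le _) (Finset.mem_range.2 (by omega))
  choose l hl hlm using fun k => hN k (n k) (hn k) (n (k + 1)) (hn' k)
  obtain ⟨Λ, hΛ, hΛc⟩ := exists_lim_TC hT hl
  choose M hM hΛM hMΛ using fun k => (hΛ k).inv hT
  let y : ℕ → ℝ → Sd := fun k t => Rm T k (u (n k)) (M k t)
  have hPC : ∀ k, PC T (y k) := fun k => (Rm_PC (hu (n k)).1 k).comp hT (hM k)
  have hR : ∀ j, ∀ t ∈ Icc 0 T, Rec j (y (j + 1)) t (y j t) := by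
    intro j t ht
    have h1 := Rec.comp hT (hM (j + 1)) ht
      (Rm_Rm (hsoft (n (j + 1))) (Nat.le_succ j) ((hM (j + 1)).mapsTo hT ht))
    have hs := (hM j).mapsTo hT ht
    have h2 : y j t = Rm T j (u (n (j + 1))) (M (j + 1) t) := by
      change Rm T j (u (n j)) (M j t) = _
      rw [hlm j _ hs]
      congr 1
      rw [← hMΛ (j + 1) _ ((hl j).mapsTo hT hs), hΛc j _ hs, hΛM j t ht]
    rw [h2]
    exact h1
  have hE := lim_memE hT hPC hR
  refine ⟨lim y, hE, ?_⟩
  have hRy : ∀ k, ∀ t ∈ Icc 0 T, Rm T k (lim y) t = y k t := fun k t ht =>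
    Rm_eq hE.1.2 ht (lim_Rec hT hPC hR k ht)
  have hbound : ∀ k : ℕ, ∀ p ≥ N k, dE T (u p) (lim y) ≤ 4 * (1 / 2) ^ k := by
    intro k p hp
    obtain ⟨l', hl', hm'⟩ := hN k p hp (n k) (hn k)
    have := dE_le_of_match hT (hsoft p) hE.1.2 (m := k) (by positivity) ((hΛ k).comp hT hl')
      (fun t ht => by
        have h1 := hl'.mapsTo hT ht
        rw [hRy k _ ((hΛ k).mapsTo hT h1), hm' t ht]
        change _ = Rm T k (u (n k)) (M k (Λ k (l' t)))
        rw [hMΛ k _ h1])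
    refine this.trans ?_
    rw [pow_succ]
    have : (0 : ℝ) < (1 / 2) ^ k := by positivity
    linarith
  rw [Metric.tendsto_atTop]
  intro ε hε
  obtain ⟨k, hk⟩ := exists_pow_lt_of_lt_one (show (0 : ℝ) < ε / 4 by linarith)
    (show (1 / 2 : ℝ) < 1 by norm_num)
  refine ⟨N k, fun p hp => ?_⟩
  rw [Real.dist_eq, sub_zero, abs_of_nonneg (dE_nonneg hT _ _)]
  have := hbound k p hp
  linarith

/-- step functions coded by lists -/
def fL : List (ℝ × ℕ) → ℝ → Sd
  | [], _ => 0
  | p :: L, t => if p.1 ≤ t then (p.2 : Sd) else fL L t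

theorem fL_ne_top (L : List (ℝ × ℕ)) (t : ℝ) : fL L t ≠ ⊤ := by
  induction L with
  | nil => simp [fL]
  | cons p L ih =>
    unfold fL
    split_ifs
    · exact ENat.natCast_ne_top _
    · exact ih

theorem fL_PC (T : ℝ) (L : List (ℝ × ℕ)) : PC T (fL L) := by
  have h1 : ∀ t, ∃ b > t, ∀ s, t < s → s < b → fL L s = fL L t := by
    intro t
    induction L with
    | nil => exact ⟨t + 1, by linarith, fun _ _ _ => rfl⟩
    | cons p L ih =>
      obtain ⟨b, hb, h⟩ := ih
      by_cases hp : p.1 ≤ t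
      · refine ⟨t + 1, by linarith, fun s hs _ => ?_⟩
        simp [fL, hp, hp.trans hs.le]
      · push Not at hp
        refine ⟨min b p.1, lt_min hb hp, fun s hs hs2 => ?_⟩
        have h3 := lt_of_lt_of_le hs2 (min_le_right _ _)
        simp only [fL, not_le.2 hp, not_le.2 h3, if_false]
        exact h s hs (lt_of_lt_of_le hs2 (min_le_left _ _))
  have h2 : ∀ t, ∃ a < t, ∃ c, ∀ s, a < s → s < t → fL L s = c := by
    clear h1
    intro t
    induction L with
    | nil => exact ⟨t - 1, by linarith, 0, fun _ _ _ => rfl⟩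
    | cons p L ih =>
      obtain ⟨a, ha, c, h⟩ := ih
      by_cases hp : p.1 < t
      · refine ⟨p.1, hp, p.2, fun s hs _ => ?_⟩
        simp [fL, hs.le]
      · push Not at hp
        refine ⟨a, ha, c, fun s hs hs2 => ?_⟩
        simp only [fL, not_le.2 (lt_of_lt_of_le hs2 hp), if_false]
        exact h s hs hs2
  constructor
  · intro t _
    obtain ⟨b, hb, h⟩ := h1 t
    exact ⟨b, hb, fun s _ => h s⟩
  · intro t _
    obtain ⟨a, ha, c, h⟩ := h2 t
    exact ⟨a, ha, c, fun s _ => h s⟩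

theorem rep {T : ℝ} (hT : 0 < T) {w : ℝ → Sd} (hw : PC T w) (hfin : ∀ t ∈ Icc 0 T, w t ≠ ⊤) :
    ∃ L : List (ℝ × ℕ), (∀ p ∈ L, p.1 ∈ Icc 0 T) ∧ ∀ t ∈ Icc 0 T, w t = fL L t := by
  have ext : ∀ (L : List (ℝ × ℕ)) (s0 : ℝ) (I : Set ℝ), (∀ p ∈ L, p.1 ∈ Icc 0 T) → s0 ∈ Icc 0 T →
      (∀ s ∈ Ico 0 s0, w s = fL L s) → (∀ s ∈ I, s0 ≤ s → w s = w s0) → (∀ s ∈ I, 0 ≤ s) →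
      ∃ L' : List (ℝ × ℕ), (∀ p ∈ L', p.1 ∈ Icc 0 T) ∧ ∀ s ∈ I, w s = fL L' s := by
    intro L s0 I hL hs0 h1 h2 h3
    obtain ⟨n, hn⟩ := ENat.ne_top_iff_exists.1 (hfin s0 hs0)
    refine ⟨(s0, n) :: L, ?_, fun s hs => ?_⟩
    · intro p hp
      rcases List.mem_cons.1 hp with rfl | hp
      · exact hs0
      · exact hL p hp
    · unfold fL
      split_ifs with h
      · rw [h2 s hs h]; exact hn.symm
      · exact h1 s ⟨h3 s hs, not_le.1 h⟩
  set A : Set ℝ := {t | t ∈ Icc 0 T ∧ ∃ L : List (ℝ × ℕ), (∀ p ∈ L, p.1 ∈ Icc 0 T) ∧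
    ∀ s ∈ Ico 0 t, w s = fL L s} with hA
  have h0A : (0 : ℝ) ∈ A :=
    ⟨⟨le_rfl, hT.le⟩, [], by simp, fun s hs => absurd hs.1 (not_le.2 hs.2)⟩
  have hb : BddAbove A := ⟨T, fun t ht => ht.1.2⟩
  have hσ0 : 0 ≤ sSup A := le_csSup hb h0A
  have hσT : sSup A ≤ T := csSup_le ⟨0, h0A⟩ fun t ht => ht.1.2
  have hσA : sSup A ∈ A := by
    rcases eq_or_lt_of_le hσ0 with h | h
    · rw [← h]; exact h0A
    obtain ⟨a, ha, c, hc⟩ := hw.2 _ ⟨h, hσT⟩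
    obtain ⟨s0, hs0, has0⟩ := exists_lt_of_lt_csSup ⟨0, h0A⟩ ha
    rcases eq_or_lt_of_le (le_csSup hb hs0) with he | hlt
    · rw [← he]; exact hs0
    obtain ⟨hs0T, L, hL, h1⟩ := hs0
    refine ⟨⟨hσ0, hσT⟩, ext L s0 _ hL hs0T h1 (fun s hs hle => ?_) fun s hs => hs.1⟩
    rw [hc s0 hs0T has0 hlt]
    exact hc s ⟨hs.1, hs.2.le.trans hσT⟩ (lt_of_lt_of_le has0 hle) hs.2
  obtain ⟨hσI, L, hL, h1⟩ := hσA
  rcases eq_or_lt_of_le hσT with he | hlt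
  · rw [he] at h1 hσI
    refine ext L T _ hL hσI h1 (fun s hs hle => ?_) fun s hs => hs.1
    rw [le_antisymm hs.2 hle]
  · exfalso
    obtain ⟨b, hb', hbc⟩ := hw.1 _ ⟨hσ0, hlt⟩
    have hlt2 : sSup A < min b T := lt_min hb' hlt
    have : min b T ∈ A := by
      refine ⟨⟨hσ0.trans hlt2.le, min_le_right _ _⟩,
        ext L _ _ hL hσI h1 (fun s hs hle => ?_) fun s hs => hs.1⟩
      rcases eq_or_lt_of_le hle with h | h
      · rw [← h]
      · exact hbc s ⟨hs.1, hs.2.le.trans (min_le_right _ _)⟩ h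
          (lt_of_lt_of_le hs.2 (min_le_left _ _))
    exact absurd (le_csSup hb this) (not_le.2 hlt2)

theorem movable {T : ℝ} (hT : 0 < T) (F : Finset ℝ) {b : ℝ} (hb : 0 < b) :
    ∃ (r : ℝ → ℚ) (l : ℝ → ℝ), TC T l b ∧ ∀ f ∈ F, l f = T * r f := by
  classical
  set G : Finset ℝ := insert 0 (insert T F) with hG
  obtain ⟨η, hη, hsep⟩ : ∃ η > 0, ∀ p ∈ G, ∀ q ∈ G, p ≠ q → η ≤ |p - q| := by
    set Q := (G ×ˢ G).filter fun p => p.1 ≠ p.2 with hQ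
    have hne : Q.Nonempty := ⟨(0, T), by simp [hQ, hG, hT.ne]⟩
    obtain ⟨p, hp, hmin⟩ := Q.exists_min_image (fun p => |p.1 - p.2|) hne
    refine ⟨|p.1 - p.2|, ?_, fun p' hp' q' hq' hne => hmin (p', q') ?_⟩
    · exact abs_pos.2 (sub_ne_zero.2 (Finset.mem_filter.1 hp).2)
    · simp only [hQ, Finset.mem_filter, Finset.mem_product]
      exact ⟨⟨hp', hq'⟩, hne⟩
  set δ : ℝ := 1 - Real.exp (-b) with hδ
  have hδ0 : 0 < δ := by
    have : Real.exp (-b) < 1 := by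
      have h9 := Real.exp_lt_exp.2 (show -b < 0 by linarith)
      rwa [Real.exp_zero] at h9
    linarith
  have hr : ∀ t : ℝ, ∃ r : ℚ, |T * r - t| ≤ δ * η / 2 ∧ (t = 0 → r = 0) ∧ (t = T → r = 1) := by
    intro t
    have hpos : 0 < δ * η / 2 := by positivity
    by_cases h0 : t = 0
    · exact ⟨0, by simp [h0, hpos.le], fun _ => rfl, fun h => absurd (h0.symm.trans h) hT.ne⟩
    by_cases h1 : t = T
    · exact ⟨1, by simp [h1, hpos.le], fun h => absurd h h0, fun _ => rfl⟩
    have hd : (t - δ * η / 2) / T < (t + δ * η / 2) / T := by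
      apply div_lt_div_of_pos_right _ hT; linarith
    obtain ⟨r, hr1, hr2⟩ := exists_rat_btwn hd
    rw [div_lt_iff₀ hT] at hr1
    rw [lt_div_iff₀ hT] at hr2
    refine ⟨r, ?_, fun h => absurd h h0, fun h => absurd h h1⟩
    rw [abs_le]; constructor <;> linarith
  choose r hr1 hr2 hr3 using hr
  have hLip : LipschitzOnWith (Real.toNNReal δ) (fun t => T * r t - t) (G : Set ℝ) := by
    apply LipschitzOnWith.of_dist_le_mul
    intro p hp q hq
    rw [Real.coe_toNNReal _ hδ0.le, Real.dist_eq, Real.dist_eq]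
    by_cases hpq : p = q
    · simp [hpq]
    have h1 := hsep p hp q hq hpq
    calc |T * r p - p - (T * r q - q)| ≤ |T * r p - p| + |T * r q - q| := abs_sub _ _
      _ ≤ δ * η / 2 + δ * η / 2 := add_le_add (hr1 p) (hr1 q)
      _ = δ * η := by ring
      _ ≤ _ := mul_le_mul_of_nonneg_left h1 hδ0.le
  obtain ⟨g, hg, hge⟩ := hLip.extend_real
  have hval : ∀ f ∈ G, f + g f = T * r f := by
    intro f hf
    rw [← hge (show f ∈ (G : Set ℝ) from hf)]; ring
  refine ⟨r, fun t => t + g t, ⟨?_, ?_, fun s _ t _ hst => ?_⟩, fun f hf => hval f (by simp [hG, hf])⟩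
  · have := hval 0 (by simp [hG])
    simpa [hr2 0 rfl] using this
  · have := hval T (by simp [hG])
    simpa [hr3 T rfl] using this
  · have h1 := hg.dist_le_mul t s
    rw [Real.coe_toNNReal _ hδ0.le, Real.dist_eq, Real.dist_eq, abs_of_nonneg (sub_nonneg.2 hst),
      abs_le] at h1
    have e1 := Real.add_one_le_exp b
    have e2 := Real.add_one_le_exp (-b)
    have hp : 0 ≤ t - s := sub_nonneg.2 hst
    have h3 : (1 + δ) * (t - s) ≤ Real.exp b * (t - s) :=
      mul_le_mul_of_nonneg_right (by rw [hδ]; linarith) hp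
    have h4 : Real.exp (-b) * (t - s) = (1 - δ) * (t - s) := by rw [hδ]; ring
    rw [h4]
    constructor
    · linarith [h1.1]
    · linarith [h1.2]

theorem fL_map {T : ℝ} {l : ℝ → ℝ} {b : ℝ} (hl : TC T l b) {r : ℝ → ℚ}
    {t : ℝ} (ht : t ∈ Icc 0 T) (L : List (ℝ × ℕ))
    (hL : ∀ p ∈ L, p.1 ∈ Icc 0 T ∧ l p.1 = T * r p.1) :
    fL (L.map fun p => (T * (r p.1 : ℝ), p.2)) (l t) = fL L t := by
  induction L with
  | nil => rfl
  | cons p L ih =>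
    have ih' := ih fun q hq => hL q (List.mem_cons_of_mem _ hq)
    obtain ⟨h1, h2⟩ := hL p List.mem_cons_self
    have h3 : T * (r p.1 : ℝ) ≤ l t ↔ p.1 ≤ t := by
      rw [← h2]; exact hl.strictMono.le_iff_le h1 ht
    simp only [List.map_cons, fL, h3, ih']

theorem separable {T : ℝ} (hT : 0 < T) : ∃ s : ℕ → ℝ → Sd, (∀ n, memE T (s n)) ∧
    ∀ x : ℝ → Sd, memE T x → ∀ ε > (0:ℝ), ∃ n, dE T x (s n) < ε := by
  classical
  obtain ⟨e, he⟩ := exists_surjective_nat (List (ℚ × ℕ))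
  refine ⟨fun n => fL ((e n).map fun p => (T * (p.1 : ℝ), p.2)), fun n =>
    (fL_PC T _).memE hT (fL_ne_top _), fun x hx ε hε => ?_⟩
  obtain ⟨m, hm⟩ := exists_pow_lt_of_lt_one (show (0 : ℝ) < ε / 2 by linarith)
    (show (1 / 2 : ℝ) < 1 by norm_num)
  have hle : ∀ t ∈ Icc 0 T, Rm T m x t ≤ (m : Sd) := fun t ht => (Rm_spec hx.1.2 m ht).le
  obtain ⟨L, hL, hrep⟩ := rep hT (Rm_PC hx.1 m)
    fun t ht => ne_top_of_le_ne_top (ENat.natCast_ne_top m) (hle t ht)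
  obtain ⟨r, l, hl, hlr⟩ := movable hT (L.map Prod.fst).toFinset (b := ε / 4) (by linarith)
  obtain ⟨n, hn⟩ := he (L.map fun p => (r p.1, p.2))
  refine ⟨n, ?_⟩
  set z := fL ((e n).map fun p => (T * (p.1 : ℝ), p.2)) with hz
  have hzs : ∀ t ∈ Ioc 0 T, softLeftLim T z t := (fL_PC T _).softLeft
  have hzl : ∀ t ∈ Icc 0 T, z (l t) = Rm T m x t := by
    intro t ht
    rw [hrep t ht, hz, hn, List.map_map]
    refine fL_map hl ht L fun p hp => ⟨hL p hp, hlr _ ?_⟩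
    simp only [List.mem_toFinset, List.mem_map]
    exact ⟨p, hp, rfl⟩
  have := dE_le_of_match hT hx.1.2 hzs (m := m) (by linarith) hl fun t ht => by
    have h1 := hl.mapsTo hT ht
    rw [← hzl t ht]
    exact (Rm_spec hzs m h1).eq_of_le h1.1 (by rw [hzl t ht]; exact hle t ht)
  refine lt_of_le_of_lt this ?_
  rw [pow_succ]
  linarith

end Soft

end


open Soft Filter Topology in
/-- The space `E([0,T], S_d)` endowed with the metric
`d(x,y) = Σ_m 2^{-(m+1)} d_S(R_m x, R_m y)` is complete and separable. -/
theorem stmt14 (T : ℝ) (hT : 0 < T) :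
    (∀ u : ℕ → ℝ → Soft.Sd, (∀ n, Soft.memE T (u n)) →
      (∀ ε > (0:ℝ), ∃ N : ℕ, ∀ p ≥ N, ∀ q ≥ N, Soft.dE T (u p) (u q) < ε) →
      ∃ x : ℝ → Soft.Sd, Soft.memE T x ∧
        Filter.Tendsto (fun n => Soft.dE T (u n) x) Filter.atTop (𝓝 0)) ∧
    (∃ s : ℕ → ℝ → Soft.Sd, (∀ n, Soft.memE T (s n)) ∧
      ∀ x : ℝ → Soft.Sd, Soft.memE T x → ∀ ε > (0:ℝ), ∃ n, Soft.dE T x (s n) < ε) := by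
  exact ⟨fun u hu hC => Soft.complete hT u hu hC, Soft.separable hT⟩
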